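/- arXiv:math/0201002 — 3 statements merged into one kernel-verified Lean document; each statement's English description precedes it below -/
import Mathlib

section
/- Corollary B: Let G be a finitely generated group which is residually torsion-free word-hyperbolic, i.e., for every g ∈ G with g ≠ 1 there exists a torsion-free word-hyperbolic group C and a group homomorphism φ : G → C with φ(g) ≠ 1. Then the Frattini subgroup F(G) of G is trivial. -/
/-- The word length of `g` with respect to a generating set `S`:
the least `n` such that `g` is a product of `n` elements of `S ∪ S⁻¹`. -/
noncomputable def wordLength {G : Type*} [Group G] (S : Set G) (g : G) : ℕ :=
  sInf {n : ℕ | ∃ l : List G, l.length = n ∧ (∀ x ∈ l, x ∈ S ∨ x⁻¹ ∈ S) ∧ l.prod = g}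

/-- The word metric on `G` with respect to a generating set `S`. -/
noncomputable def wordDist {G : Type*} [Group G] (S : Set G) (g h : G) : ℕ :=
  wordLength S (g⁻¹ * h)

/-- The word metric on `G` w.r.t. `S` satisfies the Gromov
four-point condition with constant `δ`. -/
def GromovFourPoint {G : Type*} [Group G] (S : Set G) (δ : ℝ) : Prop :=
  ∀ x y z w : G,
    (wordDist S x y : ℝ) + (wordDist S z w : ℝ) ≤
      max ((wordDist S x z : ℝ) + (wordDist S y w : ℝ))
          ((wordDist S x w : ℝ) + (wordDist S y z : ℝ)) + 2 * δ

/-- A group is word-hyperbolic if it has a finite generating set whose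
word metric satisfies the Gromov four-point condition for some `δ ≥ 0`. -/
def IsWordHyperbolic (G : Type*) [Group G] : Prop :=
  ∃ S : Finset G, Subgroup.closure (S : Set G) = ⊤ ∧
    ∃ δ : ℝ, 0 ≤ δ ∧ GromovFourPoint (S : Set G) δ


/-- A left-invariant, proper, Gromov-hyperbolic integer-valued pseudometric on a group. -/
structure HypMet (C : Type*) [Group C] (d : C → C → ℤ) (D : ℤ) : Prop where
  inv : ∀ g x y, d (g * x) (g * y) = d x y
  self : ∀ x, d x x = 0
  comm : ∀ x y, d x y = d y x
  tri : ∀ x y z, d x z ≤ d x y + d y z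
  hyp : ∀ x y z w, d x y + d z w ≤ d x z + d y w + D ∨ d x y + d z w ≤ d x w + d y z + D
  fin : ∀ R, {x | d 1 x ≤ R}.Finite
  nn : 0 ≤ D

namespace HypMet

variable {C : Type*} [Group C] {d : C → C → ℤ} {D : ℤ}

lemma pos (h : HypMet C d D) (x y : C) : 0 ≤ d x y := by
  have h1 := h.tri x y x
  have h2 := h.self x
  have h3 := h.comm x y
  omega

lemma one_inv_mul (h : HypMet C d D) (x y : C) : d 1 (x⁻¹ * y) = d x y := by
  have := h.inv x 1 (x⁻¹ * y)
  rw [mul_one, mul_inv_cancel_left] at this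
  exact this.symm

lemma d_mul (h : HypMet C d D) (x y : C) : d x (x * y) = d 1 y := by
  have := h.inv x 1 y
  rwa [mul_one] at this

lemma d_inv (h : HypMet C d D) (x : C) : d 1 x⁻¹ = d 1 x := by
  have := h.one_inv_mul x 1
  rw [mul_one] at this
  rw [this, h.comm]

/-- Hyperbolicity for (doubled) Gromov products based at `b`. -/
lemma gp (h : HypMet C d D) (b x y z : C) :
    d b x + d b y - d x y - D ≤ d b x + d b z - d x z ∨
    d b y + d b z - d y z - D ≤ d b x + d b z - d x z := by
  have := h.hyp x z y b
  have h1 := h.comm x b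
  have h2 := h.comm y b
  have h3 := h.comm z b
  have h4 := h.comm z y
  omega

/-- Powers of an element form a quasi-line. -/
def Q (d : C → C → ℤ) (g : C) (a : ℤ) : Prop :=
  ∀ i j k : ℤ, i ≤ j → j ≤ k → d (g ^ i) (g ^ j) + d (g ^ j) (g ^ k) - d (g ^ i) (g ^ k) ≤ a

/-- Ping-pong lemma for reduced words. -/
lemma word_long (h : HypMet C d D) {ι : Type*} (W : ι × Bool → C) (A : ℤ)
    (hinv : ∀ i b, W (i, !b) = (W (i, b))⁻¹)
    (hA : ∀ a b, a ≠ b → d 1 (W a) + d 1 (W b) - d (W a) (W b) ≤ A)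
    (hl : ∀ a, A + D < d 1 (W a)) (L : List (ι × Bool)) :
    ∀ a, FreeGroup.IsReduced (a :: L) →
      2 * d 1 (W a) - A - D ≤
        d 1 (W a) + d 1 ((a :: L).map W).prod - d (W a) ((a :: L).map W).prod := by
  induction L with
  | nil =>
    intro a _
    have h1 := hl a
    have h2 := h.self (W a)
    have h3 := h.self 1
    have hD := h.nn
    simp only [List.map_cons, List.map_nil, List.prod_cons, List.prod_nil, mul_one]
    by_cases hA0 : 0 ≤ A
    · omega
    · exfalso
      have := hA a (a.1, !a.2) (by intro e; have := congrArg Prod.snd e; simp at this)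
      have h4 := hl (a.1, !a.2)
      have h5 := h.tri (W a) 1 (W (a.1, !a.2))
      have h6 := h.comm (W a) 1
      omega
  | cons b L ih =>
    intro a hr
    rw [FreeGroup.isReduced_cons_cons] at hr
    have ihb := ih b hr.2
    set P' := ((b :: L).map W).prod with hP'
    have e1 : ((a :: b :: L).map W).prod = W a * P' := by simp [hP']
    rw [e1]
    have hne : (a.1, !a.2) ≠ b := by
      rintro rfl
      have := hr.1 rfl
      simp at this
    have k1 := hA _ _ hne
    have e2 : W (a.1, !a.2) = (W a)⁻¹ := hinv a.1 a.2
    rw [e2] at k1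
    have k2 := h.gp 1 (W a)⁻¹ P' (W b)
    have k3 := hl b
    have k4 := h.d_inv (W a)
    have k5 : d (W a)⁻¹ P' = d 1 (W a * P') := by
      have := h.inv (W a) (W a)⁻¹ P'
      rw [mul_inv_cancel] at this
      exact this.symm
    have k6 := h.d_mul (W a) P'
    have k7 := h.comm P' (W b)
    omega

/-- Loxodromic criterion, one-sided statement. -/
lemma lox_aux (h : HypMet C d D) (x : C) (hx : d 1 x + 2 * D + 1 ≤ d 1 (x * x)) (n : ℕ) :
    d 1 x⁻¹ + d 1 (x ^ n) - d x⁻¹ (x ^ n) ≤ 2 * d 1 x - d 1 (x * x) + D ∧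
    2 * d 1 x - (2 * d 1 x - d 1 (x * x)) - D ≤
      d 1 x + d 1 (x ^ (n + 1)) - d x (x ^ (n + 1)) := by
  have hD := h.nn
  have k4 := h.d_inv x
  have key : ∀ y, d x⁻¹ y = d 1 (x * y) := fun y => by
    have := h.inv x x⁻¹ y
    rw [mul_inv_cancel] at this
    exact this.symm
  have t1 := h.tri 1 x (x * x)
  have t2 := h.d_mul x x
  induction n with
  | zero =>
    have h2 := h.self x
    have h3 := h.self 1
    have h5 := h.comm x⁻¹ 1
    simp only [pow_zero, zero_add, pow_one]
    omega
  | succ n ih =>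
    have k1 := key x
    have k2 := h.gp 1 x⁻¹ (x ^ (n + 1)) x
    have k3 := key (x ^ (n + 1))
    have k5 := h.comm x (x ^ (n + 1))
    have k6 := h.d_mul x (x ^ (n + 1))
    rw [pow_succ' x (n + 1)]
    omega

lemma lox_Q (h : HypMet C d D) (x : C) (hx : d 1 x + 2 * D + 1 ≤ d 1 (x * x)) :
    ∃ a, Q d x a := by
  have hD := h.nn
  have t1 := h.tri 1 x (x * x)
  have t2 := h.d_mul x x
  have hx' : d 1 x⁻¹ + 2 * D + 1 ≤ d 1 (x⁻¹ * x⁻¹) := by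
    have e : x⁻¹ * x⁻¹ = (x * x)⁻¹ := by group
    rw [e, h.d_inv, h.d_inv]; exact hx
  have ei : d 1 (x⁻¹ * x⁻¹) = d 1 (x * x) := by
    have e : x⁻¹ * x⁻¹ = (x * x)⁻¹ := by group
    rw [e, h.d_inv]
  have main : ∀ m n : ℕ, d 1 (x⁻¹ ^ m) + d 1 (x ^ n) - d (x⁻¹ ^ m) (x ^ n) ≤
      2 * d 1 x - d 1 (x * x) + 2 * D := by
    intro m n
    rcases m with _ | m
    · have := h.self 1
      simp only [pow_zero]
      omega
    · have k1 := (h.lox_aux x hx n).1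
      have k2 := (h.lox_aux x⁻¹ hx' m).2
      have k3 := h.gp 1 x⁻¹ (x⁻¹ ^ (m + 1)) (x ^ n)
      have k4 := h.d_inv x
      omega
  refine ⟨2 * d 1 x - d 1 (x * x) + 2 * D, fun i j k hij hjk => ?_⟩
  have := main (j - i).toNat (k - j).toNat
  have e1 : x⁻¹ ^ (j - i).toNat = x ^ (i - j) := by
    rw [inv_pow, ← zpow_natCast, ← zpow_neg]; congr 1; omega
  have e2 : x ^ (k - j).toNat = x ^ (k - j) := by
    rw [← zpow_natCast]; congr 1; omega
  rw [e1, e2] at this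
  have f1 : d 1 (x ^ (i - j)) = d (x ^ j) (x ^ i) := by
    rw [← h.one_inv_mul (x ^ j)]; congr 1; group
  have f2 : d 1 (x ^ (k - j)) = d (x ^ j) (x ^ k) := by
    rw [← h.one_inv_mul (x ^ j)]; congr 1; group
  have f3 : d (x ^ (i - j)) (x ^ (k - j)) = d (x ^ i) (x ^ k) := by
    rw [← h.inv (x ^ j), ← zpow_add, ← zpow_add]; congr 2 <;> congr 1 <;> ring
  rw [f1, f2, f3, h.comm (x ^ j) (x ^ i)] at this
  exact this

lemma Q_conj (h : HypMet C d D) (y g : C) (a : ℤ) (hQ : Q d (y⁻¹ * g * y) a) :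
    ∃ a', Q d g a' := by
  have key : ∀ i j : ℤ, d (g ^ i) (g ^ j) - 2 * d 1 y ≤
      d ((y⁻¹ * g * y) ^ i) ((y⁻¹ * g * y) ^ j) ∧
      d ((y⁻¹ * g * y) ^ i) ((y⁻¹ * g * y) ^ j) ≤ d (g ^ i) (g ^ j) + 2 * d 1 y := by
    intro i j
    have e : ∀ i : ℤ, (y⁻¹ * g * y) ^ i = y⁻¹ * (g ^ i * y) := by
      intro i
      have := conj_zpow (i := i) (a := y⁻¹) (b := g)
      rw [inv_inv] at this
      rw [this, mul_assoc]
    rw [e, e, h.inv]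
    have t1 := h.tri (g ^ i * y) (g ^ i) (g ^ j * y)
    have t2 := h.tri (g ^ i) (g ^ j) (g ^ j * y)
    have t3 := h.tri (g ^ i) (g ^ i * y) (g ^ j)
    have t4 := h.tri (g ^ i * y) (g ^ j * y) (g ^ j)
    have e1 := h.d_mul (g ^ i) y
    have e2 := h.d_mul (g ^ j) y
    have e3 := h.comm (g ^ i) (g ^ i * y)
    have e4 := h.comm (g ^ j) (g ^ j * y)
    omega
  refine ⟨a + 6 * d 1 y, fun i j k hij hjk => ?_⟩
  have := hQ i j k hij hjk
  have k1 := key i j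
  have k2 := key j k
  have k3 := key i k
  omega

/-- The key displacement-reduction step. -/
lemma reduce_step (h : HypMet C d D) (s s0 m : C) (hc : s * s0 = s0 * s)
    (hL : 20 * D + 20 ≤ d 1 s0) (hs : d 1 s ≤ d 1 s0)
    (hn : d 1 (s * s) ≤ d 1 s + 2 * D)
    (hm : d 1 m = 2 * D + 1) (hm' : d m s0 = d 1 s0 - (2 * D + 1)) :
    d m (s * m) ≤ d 1 s0 - 1 := by
  have hD := h.nn
  by_cases hsm : d 1 s < d 1 s0 - 2 * (2 * D + 1)
  · have t1 := h.tri m 1 (s * m)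
    have t2 := h.tri 1 s (s * m)
    have t3 := h.d_mul s m
    have t4 := h.comm m 1
    omega
  have claim : ∀ t : C, t * s0 = s0 * t → d 1 t = d 1 s → d 1 (t * t) ≤ d 1 t + 2 * D →
      2 * (2 * D + 1) ≤ d 1 t + d 1 s0 - d t s0 := by
    intro t htc ht htn
    by_contra hcon
    have k1 := h.gp 1 t t⁻¹ s0
    have k2 : d t⁻¹ s0 = d 1 (t * s0) := by
      have := h.inv t t⁻¹ s0
      rw [mul_inv_cancel] at this
      exact this.symm
    have k3 : d t t⁻¹ = d 1 (t * t) := by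
      rw [h.comm]
      have := h.inv t t⁻¹ t
      rw [mul_inv_cancel] at this
      exact this.symm
    have k4 := h.d_inv t
    have k5 := h.gp 1 t (t * s0) s0
    have k6 := h.d_mul t s0
    have k7 : d (t * s0) s0 = d 1 t := by
      rw [htc, h.comm, h.d_mul]
    omega
  have c1 := claim s hc rfl hn
  have c2 := claim s⁻¹ (by
    rw [inv_mul_eq_iff_eq_mul, ← mul_assoc, hc, mul_inv_cancel_right]) (h.d_inv s) (by
    have e : s⁻¹ * s⁻¹ = (s * s)⁻¹ := by group
    rw [e, h.d_inv, h.d_inv]; exact hn)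
  have g1 := h.gp 1 m s0 s
  have g2 := h.gp 1 m s0 s⁻¹
  have e1 : d m s⁻¹ = d 1 (s * m) := by
    have := h.inv s s⁻¹ m
    rw [mul_inv_cancel] at this
    rw [h.comm]
    exact this.symm
  have e2 := h.d_inv s
  have e3 := h.hyp m (s * m) 1 s
  have e4 := h.d_mul s m
  have e5 := h.comm s (s * m)
  have e6 := h.comm m 1
  have e7 := h.comm (s * m) 1
  have e8 := h.comm s0 s
  have e9 := h.comm s0 s⁻¹
  omega

lemma exists_Q (h : HypMet C d D)
    (geo : ∀ x r, 0 ≤ r → r ≤ d 1 x → ∃ m, d 1 m = r ∧ d m x = d 1 x - r)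
    (g : C) (hg : ¬ IsOfFinOrder g) : ∃ k : ℕ, 0 < k ∧ ∃ a, Q d (g ^ k) a := by
  by_contra hcon
  have hD := h.nn
  have nl : ∀ (y : C) (k : ℕ), 0 < k →
      d 1 ((y⁻¹ * g ^ k * y) * (y⁻¹ * g ^ k * y)) ≤ d 1 (y⁻¹ * g ^ k * y) + 2 * D := by
    intro y k hk
    by_contra hlt
    obtain ⟨a, ha⟩ := h.lox_Q (y⁻¹ * g ^ k * y) (by omega)
    exact hcon ⟨k, hk, h.Q_conj y _ a ha⟩
  have hfin := h.fin (20 * D + 20)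
  set K := hfin.toFinset.card + 1 with hK
  let M : ℕ → Prop := fun n => ∃ y : C, ∀ k ∈ Finset.Icc 1 K, d 1 (y⁻¹ * g ^ k * y) ≤ n
  have hM : ∃ n, M n := by
    refine ⟨(∑ k ∈ Finset.Icc 1 K, d 1 ((1 : C)⁻¹ * g ^ k * 1)).toNat, 1, fun k hk => ?_⟩
    have := Finset.single_le_sum (f := fun k => d 1 ((1 : C)⁻¹ * g ^ k * 1))
      (fun i _ => h.pos _ _) hk
    omega
  classical
  obtain ⟨y, hy⟩ := Nat.find_spec hM
  have hmin := fun n => Nat.find_min (m := n) hM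
  set n := Nat.find hM with hn
  by_cases hsmall : (n : ℤ) ≤ 20 * D + 20
  · have : (Finset.Icc 1 K).card ≤ hfin.toFinset.card := by
      apply Finset.card_le_card_of_injOn (fun k => y⁻¹ * g ^ k * y)
      · intro k hk
        have := hy k hk
        simp only [Set.Finite.coe_toFinset, Set.mem_ofPred_eq]
        omega
      · intro k _ l _ hkl
        simp only [mul_left_inj, mul_right_inj] at hkl
        exact (injective_pow_iff_not_isOfFinOrder.2 hg) hkl
    simp [hK] at this
  · have hn1 : n - 1 < n := by omega
    have : ∃ k ∈ Finset.Icc 1 K, d 1 (y⁻¹ * g ^ k * y) = n := by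
      by_contra hne
      push Not at hne
      apply hmin _ hn1
      refine ⟨y, fun k hk => ?_⟩
      have h1 := hy k hk
      have h2 := hne k hk
      omega
    obtain ⟨k0, hk0, hk0n⟩ := this
    obtain ⟨m, hm, hm'⟩ := geo (y⁻¹ * g ^ k0 * y) (2 * D + 1) (by omega) (by omega)
    apply hmin _ hn1
    refine ⟨y * m, fun k hk => ?_⟩
    have hkpos : 0 < k := by
      have := (Finset.mem_Icc.1 hk).1
      omega
    have := h.reduce_step (y⁻¹ * g ^ k * y) (y⁻¹ * g ^ k0 * y) m ?_ (by omega)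
      (by rw [hk0n]; exact hy k hk) (nl y k hkpos) hm hm'
    · have e : d 1 ((y * m)⁻¹ * g ^ k * (y * m)) = d m (y⁻¹ * g ^ k * y * m) := by
        rw [← h.one_inv_mul m]; congr 1; group
      rw [e]
      omega
    · have e1 : y⁻¹ * g ^ k * y * (y⁻¹ * g ^ k0 * y) = y⁻¹ * (g ^ k * g ^ k0) * y := by group
      have e2 : y⁻¹ * g ^ k0 * y * (y⁻¹ * g ^ k * y) = y⁻¹ * (g ^ k0 * g ^ k) * y := by group
      rw [e1, e2, ← pow_add, ← pow_add, add_comm]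

end HypMet

namespace HypMet

variable {C : Type*} [Group C] {d : C → C → ℤ} {D : ℤ}

/-- The commensurator-type subgroup of `g`. -/
def E (g : C) : Subgroup C where
  carrier := {w | ∃ a b : ℤ, a ≠ 0 ∧ b ≠ 0 ∧ w * g ^ a * w⁻¹ = g ^ b}
  one_mem' := ⟨1, 1, by simp, by simp, by simp⟩
  mul_mem' := by
    rintro x y ⟨a, b, ha, hb, hab⟩ ⟨a', b', ha', hb', hab'⟩
    refine ⟨a' * a, b * b', mul_ne_zero ha' ha, mul_ne_zero hb hb', ?_⟩
    have e : x * y * g ^ (a' * a) * (x * y)⁻¹ = x * ((y * g ^ a' * y⁻¹) ^ a) * x⁻¹ := by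
      rw [conj_zpow, zpow_mul]; group
    rw [e, hab', ← zpow_mul, mul_comm b' a, zpow_mul, ← conj_zpow, hab, ← zpow_mul]
  inv_mem' := by
    rintro x ⟨a, b, ha, hb, hab⟩
    refine ⟨b, a, hb, ha, ?_⟩
    rw [← hab]; group

lemma mem_E {g w : C} : w ∈ E g ↔ ∃ a b : ℤ, a ≠ 0 ∧ b ≠ 0 ∧ w * g ^ a * w⁻¹ = g ^ b := Iff.rfl

lemma zpow_inj {g : C} (hg : ¬ IsOfFinOrder g) {i j : ℤ} (e : g ^ i = g ^ j) : i = j :=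
  (injective_zpow_iff_not_isOfFinOrder.2 hg) e

lemma pow_len (h : HypMet C d D) (g : C) (n : ℕ) : d 1 (g ^ n) ≤ n * d 1 g := by
  induction n with
  | zero => simp [h.self]
  | succ n ih =>
    have t := h.tri 1 (g ^ n) (g ^ (n + 1))
    rw [pow_succ, h.d_mul] at t
    rw [pow_succ]
    push_cast
    linarith

lemma zpow_len (h : HypMet C d D) (g : C) (n : ℤ) : d 1 (g ^ n) ≤ |n| * d 1 g := by
  rcases Int.natAbs_eq n with e | e
  · rw [Int.abs_eq_natAbs, e, zpow_natCast, Int.natAbs_natCast]; exact h.pow_len g _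
  · rw [Int.abs_eq_natAbs, e, zpow_neg, h.d_inv, zpow_natCast, Int.natAbs_neg, Int.natAbs_natCast]
    exact h.pow_len g _

lemma exists_far (h : HypMet C d D) {g : C} (hg : ¬ IsOfFinOrder g) (R : ℤ) :
    ∃ n : ℕ, 0 < n ∧ R < d 1 (g ^ n) := by
  by_contra hcon
  push Not at hcon
  have hinj := injective_pow_iff_not_isOfFinOrder.2 hg
  have : (Set.Ioi (0 : ℕ)).Finite := by
    apply Set.Finite.of_finite_image ((h.fin R).subset _) (f := fun n => g ^ n) hinj.injOn
    rintro _ ⟨n, hn, rfl⟩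
    exact hcon n hn
  exact (Set.Ioi_infinite 0) this

/-- Discrete walk: first index with `P`. -/
lemma walk (P : ℕ → Prop) (N : ℕ) (hN : P N) :
    ∃ j ≤ N, P j ∧ (j = 0 ∨ ∃ i, j = i + 1 ∧ ¬ P i) := by
  classical
  have hex : ∃ n, P n := ⟨N, hN⟩
  refine ⟨Nat.find hex, Nat.find_min' hex hN, Nat.find_spec hex, ?_⟩
  rcases hj : Nat.find hex with _ | i
  · exact Or.inl rfl
  · refine Or.inr ⟨i, rfl, Nat.find_min hex (by omega)⟩

/-- Symmetric form of `Q`. -/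
lemma Q_pos (h : HypMet C d D) {g : C} {a : ℤ} (hQ : Q d g a) (n : ℤ) (i : ℕ) (hi : i ≤ n.natAbs) :
    d 1 (g ^ (n.sign * i)) + d (g ^ (n.sign * i)) (g ^ n) - d 1 (g ^ n) ≤ a := by
  rcases le_total 0 n with hn | hn
  · rcases hn.eq_or_lt with rfl | hn
    · have := hQ 0 0 0 le_rfl le_rfl
      simpa using this
    · have := hQ 0 i n (by omega) (by omega)
      rw [Int.sign_eq_one_of_pos hn, one_mul]
      simpa using this
  · rcases hn.eq_or_lt with rfl | hn
    · have := hQ 0 0 0 le_rfl le_rfl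
      simpa using this
    · have := hQ n (-i) 0 (by omega) (by omega)
      rw [Int.sign_eq_neg_one_of_neg hn, neg_one_mul]
      rw [zpow_zero, h.comm _ 1, h.comm _ 1, h.comm (g ^ n) _] at this
      omega

lemma sign_mul_natAbs' (n : ℤ) : n.sign * (n.natAbs : ℤ) = n := Int.sign_mul_natAbs n

lemma gp_bounded (h : HypMet C d D) {g : C} {a : ℤ} (hg : ¬ IsOfFinOrder g) (hQ : Q d g a)
    (w : C) (hw : w ∉ E g) :
    ∃ B, ∀ n m : ℤ, d 1 (g ^ n) + d 1 (w * g ^ m) - d (g ^ n) (w * g ^ m) ≤ B := by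
  have hD := h.nn
  have ha0 : 0 ≤ a := by
    have ha := hQ 0 0 0 le_rfl le_rfl
    rw [h.self] at ha
    omega
  have hfin := h.fin (a + d 1 g + 3 * d 1 w + 2 * D)
  set I := hfin.toFinset.card + 1 with hI
  have hpg := h.pos 1 g
  have hpw := h.pos 1 w
  refine ⟨2 * (I * d 1 g) + 2 * d 1 w, fun n m => ?_⟩
  by_contra hlt
  push Not at hlt
  have hn1 := h.tri 1 (g ^ n) (w * g ^ m)
  have hn2 := h.tri 1 (w * g ^ m) (g ^ n)
  have hn3 := h.comm (g ^ n) (w * g ^ m)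
  have hnI : I ≤ n.natAbs := by
    by_contra hc
    have k := h.zpow_len g n
    have : |n| * d 1 g ≤ I * d 1 g := by
      apply mul_le_mul_of_nonneg_right _ hpg
      rw [Int.abs_eq_natAbs]; omega
    omega
  have key : ∀ i : ℕ, i ≤ I → ∃ j : ℤ,
      d (g ^ (n.sign * i)) (w * g ^ j) ≤ a + d 1 g + 3 * d 1 w + 2 * D := by
    intro i hi
    have q1 := h.Q_pos hQ n i (by omega)
    have li : d 1 (g ^ (n.sign * i)) ≤ I * d 1 g := by
      refine (h.zpow_len g _).trans (mul_le_mul_of_nonneg_right ?_ hpg)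
      rw [abs_mul]
      have : |n.sign| ≤ 1 := by
        rcases lt_trichotomy n 0 with h | h | h
        · rw [Int.sign_eq_neg_one_of_neg h]; simp
        · rw [h]; simp
        · rw [Int.sign_eq_one_of_pos h]; simp
      have h2 : |(i : ℤ)| = i := abs_of_nonneg (by omega)
      rw [h2]
      nlinarith
    set x := g ^ (n.sign * i) with hx
    obtain ⟨j, hj, hPj, hj'⟩ := walk (fun j => d 1 x ≤ d 1 (w * g ^ (m.sign * j))) m.natAbs
      (by simp only [sign_mul_natAbs']; omega)
    refine ⟨m.sign * j, ?_⟩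
    have q2 := h.Q_pos hQ m j hj
    have up : d 1 (w * g ^ (m.sign * j)) ≤ d 1 x + d 1 g + d 1 w := by
      rcases hj' with rfl | ⟨i', rfl, hP'⟩
      · have := h.pos 1 x
        simp only [Nat.cast_zero, mul_zero, zpow_zero, mul_one]
        omega
      · have t := h.tri 1 (w * g ^ (m.sign * i')) (w * g ^ (m.sign * (i' + 1 : ℕ)))
        rw [h.inv] at t
        have e : d (g ^ (m.sign * i')) (g ^ (m.sign * (i' + 1 : ℕ))) ≤ d 1 g := by
          have : g ^ (m.sign * (i' + 1 : ℕ)) = g ^ (m.sign * i') * g ^ m.sign := by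
            rw [← zpow_add]; congr 1; push_cast; ring
          rw [this, h.d_mul]
          rcases lt_trichotomy m 0 with h' | h' | h'
          · rw [Int.sign_eq_neg_one_of_neg h', zpow_neg_one, h.d_inv]
          · rw [h']; simp [h.self, hpg]
          · rw [Int.sign_eq_one_of_pos h', zpow_one]
        push Not at hP'
        omega
    set z := g ^ (m.sign * j) with hz
    have i1 := h.inv w z (g ^ m)
    have i2 := h.d_mul w z
    have i3 := h.d_mul w (g ^ m)
    have t1 := h.tri 1 w (w * z)
    have t2 := h.tri w 1 (w * z)
    have t3 := h.tri 1 w (w * g ^ m)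
    have t4 := h.tri w 1 (w * g ^ m)
    have c1 := h.comm w 1
    have c2 := h.comm (w * g ^ m) (w * z)
    have g1 := h.gp 1 x (g ^ n) (w * g ^ m)
    have g2 := h.gp 1 x (w * g ^ m) (w * z)
    omega
  choose! j hj using key
  have hcard : hfin.toFinset.card < (Finset.range (I + 1)).card := by simp [hI]
  obtain ⟨i1, hi1, i2, hi2, hne, heq⟩ := Finset.exists_ne_map_eq_of_card_lt_of_maps_to hcard
    (f := fun i : ℕ => (g ^ (n.sign * i))⁻¹ * (w * g ^ (j i))) (by
      intro i hi
      have := hj i (by simpa [Nat.lt_succ_iff] using hi)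
      simp only [Set.Finite.coe_toFinset, Set.mem_ofPred_eq]
      rw [h.one_inv_mul]
      exact this)
  apply hw
  have hn0 : n ≠ 0 := by rintro rfl; simp at hnI
  have hb : n.sign * (i1 : ℤ) - n.sign * i2 ≠ 0 := by
    rw [← mul_sub]
    apply mul_ne_zero
    · rwa [Ne, Int.sign_eq_zero_iff_zero]
    · omega
  have e : w * g ^ (j i1 - j i2) * w⁻¹ = g ^ (n.sign * (i1 : ℤ) - n.sign * i2) := by
    rw [inv_mul_eq_iff_eq_mul] at heq
    rw [zpow_sub, ← mul_assoc, heq]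
    generalize n.sign * (i1 : ℤ) = p
    generalize n.sign * (i2 : ℤ) = q
    rw [zpow_sub]
    group
  refine ⟨_, _, ?_, hb, e⟩
  intro h0
  rw [h0] at e
  apply hb
  apply zpow_inj hg
  rw [← e]; simp

lemma E_near (h : HypMet C d D) {g : C} {a : ℤ} (hg : ¬ IsOfFinOrder g) (hQ : Q d g a) :
    ∃ R, ∀ w ∈ E g, ∃ j : ℤ, d w (g ^ j) ≤ R := by
  have hD := h.nn
  have hpg := h.pos 1 g
  have ha0 : 0 ≤ a := by
    have ha := hQ 0 0 0 le_rfl le_rfl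
    rw [h.self] at ha
    omega
  refine ⟨3 * a + 4 * D + 2 * d 1 g, ?_⟩
  have main : ∀ w : C, ∀ p q : ℤ, p ≠ 0 → 0 < q → w * g ^ p * w⁻¹ = g ^ q →
      ∃ j : ℤ, d w (g ^ j) ≤ 3 * a + 4 * D + 2 * d 1 g := by
    intro w p q hp hq e
    have hpw := h.pos 1 w
    have hgp : ¬ IsOfFinOrder (g ^ p) := by
      rw [← injective_zpow_iff_not_isOfFinOrder]
      intro i j hij
      simp only [← zpow_mul] at hij
      have := zpow_inj hg hij
      exact mul_left_cancel₀ hp this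
    obtain ⟨N, hN0, hN⟩ := h.exists_far hgp (a + 2 * D + 2 * d 1 w)
    have hN' : d 1 ((g ^ p) ^ (-(N : ℤ))) = d 1 ((g ^ p) ^ N) := by
      rw [zpow_neg, h.d_inv, zpow_natCast]
    have close : ∀ n : ℤ, d (w * (g ^ p) ^ n) ((g ^ q) ^ n) = d 1 w := by
      intro n
      have : w * (g ^ p) ^ n = (g ^ q) ^ n * w := by
        rw [← e, conj_zpow]; group
      rw [this, h.comm, h.d_mul]
    have c1 := close N
    have c2 := close (-N)
    have a1 := h.d_mul w ((g ^ p) ^ (N : ℤ))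
    have a2 := h.d_mul w ((g ^ p) ^ (-(N : ℤ)))
    have hsplit : d 1 ((g ^ p) ^ (N : ℤ)) + d 1 ((g ^ p) ^ (-(N : ℤ))) -
        d (w * (g ^ p) ^ (N : ℤ)) (w * (g ^ p) ^ (-(N : ℤ))) ≤ a := by
      rw [h.inv, ← zpow_mul, ← zpow_mul]
      rcases lt_or_gt_of_ne hp with hp | hp
      · have := hQ (p * N) 0 (p * (-N)) (by nlinarith) (by nlinarith)
        rw [zpow_zero, h.comm _ 1] at this
        omega
      · have := hQ (p * (-N)) 0 (p * N) (by nlinarith) (by nlinarith)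
        rw [zpow_zero, h.comm _ 1, h.comm (g ^ (p * (-(N : ℤ))))] at this
        omega
    rw [zpow_natCast (g ^ p) N] at *
    set M : ℤ := q * N with hM
    have hMpos : 0 ≤ M := by positivity
    have eM1 : (g ^ q) ^ (N : ℤ) = g ^ M := by rw [← zpow_mul]
    have eM2 : (g ^ q) ^ (-(N : ℤ)) = g ^ (-M) := by
      rw [← zpow_mul, hM]; congr 1; ring
    rw [eM1] at c1
    rw [eM2] at c2
    set X := w * (g ^ p) ^ N
    set Y := w * (g ^ p) ^ (-(N : ℤ))
    -- Gromov product at `w`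
    have t1 := h.tri w (g ^ M) X
    have t2 := h.tri w (g ^ (-M)) Y
    have s1 := h.comm X (g ^ M)
    have s2 := h.comm Y (g ^ (-M))
    have g1 := h.gp w X (g ^ M) Y
    have g2 := h.gp w (g ^ M) (g ^ (-M)) Y
    have r1 := h.tri w X (g ^ M)
    have r2 := h.tri w Y (g ^ (-M))
    have hw1 : d w (g ^ M) + d w (g ^ (-M)) - d (g ^ M) (g ^ (-M)) ≤ a + 2 * D := by omega
    -- walk
    obtain ⟨j, hj, hPj, hj'⟩ := walk
      (fun j : ℕ => d (g ^ (-M + j)) (g ^ M) + d (g ^ (-M + j)) w - d (g ^ M) w ≤ a + D)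
      (2 * M).toNat (by
        have : -M + ((2 * M).toNat : ℤ) = M := by omega
        simp only [this, h.self]
        have ha := hQ 0 0 0 le_rfl le_rfl
        rw [h.self] at ha
        omega)
    have first : d (g ^ (-M + j)) (g ^ (-M)) + d (g ^ (-M + j)) w - d (g ^ (-M)) w
        ≤ a + D + 2 * d 1 g := by
      rcases hj' with rfl | ⟨i, rfl, hPi⟩
      · have ha := hQ 0 0 0 le_rfl le_rfl
        rw [h.self] at ha
        simp only [Nat.cast_zero, add_zero, h.self]
        omega
      · push Not at hPi
        have qq := hQ (-M) (-M + i) M (by omega) (by omega)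
        have gg := h.gp (g ^ (-M + i)) (g ^ M) w (g ^ (-M))
        have u1 := h.comm (g ^ (-M + i)) (g ^ (-M))
        have u2 := h.comm w (g ^ (-M))
        have u3 := h.comm (g ^ (-M)) (g ^ M)
        have e1 : g ^ (-M + ((i + 1 : ℕ) : ℤ)) = g ^ (-M + i) * g := by
          rw [← zpow_add_one]; congr 1; push_cast; ring
        rw [e1]
        have v1 := h.d_mul (g ^ (-M + i)) g
        have v2 := h.comm (g ^ (-M + i)) (g ^ (-M + i) * g)
        have v3 := h.tri (g ^ (-M + i) * g) (g ^ (-M + i)) (g ^ (-M))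
        have v4 := h.tri (g ^ (-M + i) * g) (g ^ (-M + i)) w
        omega
    have qj := h.tri (g ^ M) (g ^ (-M + j)) (g ^ (-M))
    refine ⟨-M + j, ?_⟩
    have z1 := h.comm w (g ^ (-M + j))
    have z2 := h.comm w (g ^ M)
    have z3 := h.comm w (g ^ (-M))
    have z4 := h.comm (g ^ M) (g ^ (-M + j))
    have z5 := h.pos w (g ^ (-M + j))
    omega
  rintro w ⟨p, q, hp, hq, e⟩
  rcases lt_or_gt_of_ne hq with hq | hq
  · refine main w (-p) (-q) (by omega) (by omega) ?_
    rw [zpow_neg, zpow_neg, ← e]; group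
  · exact main w p q hp hq e

lemma E_finite (h : HypMet C d D) {g : C} {a : ℤ} (hg : ¬ IsOfFinOrder g) (hQ : Q d g a) :
    ∃ T : Set C, T.Finite ∧ ∀ w ∈ E g, ∃ j : ℤ, ∃ t ∈ T, w = g ^ j * t := by
  obtain ⟨R, hR⟩ := h.E_near hg hQ
  refine ⟨{x | d 1 x ≤ R}, h.fin R, fun w hw => ?_⟩
  obtain ⟨j, hj⟩ := hR w hw
  refine ⟨j, (g ^ j)⁻¹ * w, ?_, by group⟩
  simp only [Set.mem_ofPred_eq]
  rw [h.one_inv_mul, h.comm]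
  exact hj

end HypMet

lemma isCoatomic_subgroup_of_fg {H : Type*} [Group H] (hfg : Group.FG H) :
    IsCoatomic (Subgroup H) := by
  apply CompleteLattice.coatomic_of_top_compact
  rw [CompleteLattice.isCompactElement_iff_le_of_directed_sSup_le]
  intro s hs hdir hle
  obtain ⟨_, S, -, hS⟩ := Group.fg_iff'.1 hfg
  have : ∀ T : Finset H, ∃ K ∈ s, (T : Set H) ⊆ K := by
    intro T
    classical
    induction T using Finset.induction_on with
    | empty => obtain ⟨K, hK⟩ := hs; exact ⟨K, hK, by simp⟩
    | insert x T _ ih =>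
      obtain ⟨K, hK, hTK⟩ := ih
      have hx : x ∈ sSup s := hle trivial
      rw [Subgroup.mem_sSup_of_directedOn hs hdir] at hx
      obtain ⟨K', hK', hxK'⟩ := hx
      obtain ⟨M, hM, h1, h2⟩ := hdir K hK K' hK'
      refine ⟨M, hM, ?_⟩
      rw [Finset.coe_insert, Set.insert_subset_iff]
      exact ⟨h2 hxK', hTK.trans h1⟩
  obtain ⟨K, hK, hSK⟩ := this S
  refine ⟨K, hK, ?_⟩
  rw [← hS, Subgroup.closure_le]
  exact hSK

lemma frattini_eq_bot_of_prime {p : ℕ} [Fact p.Prime] :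
    frattini (Multiplicative (ZMod p)) = ⊥ := by
  have : IsSimpleGroup (Multiplicative (ZMod p)) :=
    isSimpleGroup_of_prime_card (p := p) (by simp)
  rw [eq_bot_iff]
  exact frattini_le_coatom isCoatom_bot

lemma frattini_comm {H : Type*} [CommGroup H] (hfg : Group.FG H)
    (htf : ∀ c : H, c ≠ 1 → ¬ IsOfFinOrder c) : frattini H = ⊥ := by
  have : AddGroup.FG (Additive H) := @AddGroup.fg_of_group_fg H _ hfg
  have : Module.Finite ℤ (Additive H) := Module.Finite.iff_addGroup_fg.2 this
  have : Module.IsTorsionFree ℤ (Additive H) := by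
    rw [Module.isTorsionFree_int_iff_isAddTorsionFree]
    refine ⟨fun n hn a b hab => ?_⟩
    have hab' : (a.toMul) ^ n = (b.toMul) ^ n := hab
    have h1 : (a.toMul * b.toMul⁻¹) ^ n = 1 := by
      rw [mul_pow, inv_pow, hab', mul_inv_cancel]
    by_contra hne
    apply htf (a.toMul * b.toMul⁻¹)
    · intro h2
      have h3 : a.toMul = b.toMul := mul_inv_eq_one.1 h2
      exact hne h3
    · exact isOfFinOrder_iff_pow_eq_one.2 ⟨n, Nat.pos_of_ne_zero hn, h1⟩
  rw [eq_bot_iff]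
  intro f hf
  by_contra hne
  let b := Module.Free.chooseBasis ℤ (Additive H)
  have : ∃ i, b.repr (Additive.ofMul f) i ≠ 0 := by
    by_contra hcon
    push Not at hcon
    apply hne
    have : b.repr (Additive.ofMul f) = 0 := Finsupp.ext hcon
    have := (LinearEquiv.map_eq_zero_iff _).1 this
    exact this
  obtain ⟨i, hi⟩ := this
  obtain ⟨p, hp1, hp⟩ := Nat.exists_infinite_primes ((b.repr (Additive.ofMul f) i).natAbs + 1)
  have : Fact p.Prime := ⟨hp⟩
  let φ : H →* Multiplicative (ZMod p) := AddMonoidHom.toMultiplicativeRight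
    (((Int.castAddHom (ZMod p))).comp (b.coord i).toAddMonoidHom)
  have hφ : Function.Surjective φ := by
    intro z
    obtain ⟨n, hn⟩ := ZMod.intCast_surjective z.toAdd
    refine ⟨(n • b i).toMul, ?_⟩
    apply Multiplicative.toAdd.injective
    rw [← hn]
    simp [φ]
  have h1 := frattini_le_comap_frattini_of_surjective hφ hf
  rw [frattini_eq_bot_of_prime, Subgroup.mem_comap, Subgroup.mem_bot] at h1
  have h2 : ((b.repr (Additive.ofMul f) i : ℤ) : ZMod p) = 0 := h1
  rw [ZMod.intCast_zmod_eq_zero_iff_dvd] at h2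
  have := Int.natAbs_dvd_natAbs.2 h2
  have := Nat.le_of_dvd (by omega) this
  simp at this
  omega

/-- A torsion-free group with a cyclic subgroup of finite index is commutative. -/
lemma comm_of_virt_cyclic {H : Type*} [Group H] (htf : ∀ c : H, c ≠ 1 → ¬ IsOfFinOrder c)
    (g : H) (hfi : (Subgroup.zpowers g).FiniteIndex) : ∀ x y : H, x * y = y * x := by
  have := hfi
  have tf : ∀ (x : H) (n : ℕ), 0 < n → x ^ n = 1 → x = 1 := by
    intro x n hn hx
    by_contra hne
    exact htf x hne (isOfFinOrder_iff_pow_eq_one.2 ⟨n, hn, hx⟩)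
  have tfz : ∀ (x : H) (n : ℤ), n ≠ 0 → x ^ n = 1 → x = 1 := by
    intro x n hn hx
    apply tf x n.natAbs (by omega)
    rcases Int.natAbs_eq n with e | e
    · rw [e, zpow_natCast] at hx; exact hx
    · rw [e, zpow_neg, inv_eq_one, zpow_natCast] at hx; exact hx
  set N := (Subgroup.zpowers g).normalCore with hN
  have : N.FiniteIndex := Subgroup.finiteIndex_normalCore _
  have hNle : N ≤ Subgroup.zpowers g := Subgroup.normalCore_le _
  have hc : N ≤ Subgroup.center H := by
    intro z hz
    rw [Subgroup.mem_center_iff]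
    intro x
    by_cases hx1 : x = 1
    · simp [hx1]
    have hz' : x * z * x⁻¹ ∈ N := Subgroup.Normal.conj_mem inferInstance z hz x
    obtain ⟨k, hk, -, hxk⟩ := Subgroup.exists_pow_mem_of_index_ne_zero
      (Subgroup.FiniteIndex.index_ne_zero (H := N)) x
    obtain ⟨p, hp⟩ := Subgroup.mem_zpowers_iff.1 (hNle hz)
    obtain ⟨q, hq⟩ := Subgroup.mem_zpowers_iff.1 (hNle hz')
    obtain ⟨r, hr⟩ := Subgroup.mem_zpowers_iff.1 (hNle hxk)
    -- raise to suitable powers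
    have e1 : x * g ^ (r * p) * x⁻¹ = g ^ (r * p) := by
      rw [zpow_mul, hr, ← conj_zpow]
      congr 1
      rw [← pow_succ', pow_succ, mul_inv_cancel_right]
    have e2 : x * g ^ (r * p) * x⁻¹ = g ^ (r * q) := by
      rw [mul_comm r p, zpow_mul, hp, ← conj_zpow, ← hq, ← zpow_mul, mul_comm]
    have e3 : g ^ (r * (p - q)) = 1 := by
      rw [mul_sub, zpow_sub, ← e2, e1, mul_inv_cancel]
    have hr0 : r ≠ 0 := by
      rintro rfl
      rw [zpow_zero] at hr
      exact hx1 (tf x k hk hr.symm)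
    have : g ^ (p - q) = 1 := by
      apply tfz _ r hr0
      rw [← zpow_mul, mul_comm, e3]
    rw [zpow_sub, mul_inv_eq_one, hp, hq] at this
    rw [eq_mul_inv_iff_mul_eq] at this
    exact this.symm
  have : (Subgroup.center H).FiniteIndex := Subgroup.finiteIndex_of_le hc
  have hinj : Function.Injective (MonoidHom.transferCenterPow H) := by
    rw [injective_iff_map_eq_one]
    intro x hx
    have := congrArg Subtype.val hx
    rw [MonoidHom.transferCenterPow_apply] at this
    exact tf x _ (Nat.pos_of_ne_zero Subgroup.FiniteIndex.index_ne_zero) this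
  intro x y
  apply hinj
  rw [map_mul, map_mul]
  exact Subtype.ext (Subgroup.mem_center_iff.1 (MonoidHom.transferCenterPow H y).2 _)

/-- Injective choice from infinitely many candidates. -/
lemma exists_inj_choice {α X : Type*} [Finite α] (s : α → Set X) (hs : ∀ a, (s a).Infinite) :
    ∃ c : α → X, Function.Injective c ∧ ∀ a, c a ∈ s a := by
  classical
  have := Fintype.ofFinite α
  have : ∀ T : Finset α, ∃ c : α → X, Set.InjOn c T ∧ ∀ a ∈ T, c a ∈ s a := by
    intro T
    induction T using Finset.induction_on with
    | empty =>
      exact ⟨fun a => (hs a).nonempty.some, by simp, by simp⟩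
    | insert x T hx ih =>
      obtain ⟨c, hc, hcs⟩ := ih
      obtain ⟨y, hy, hyT⟩ := (hs x).exists_notMem_finset (T.image c)
      refine ⟨Function.update c x y, ?_, ?_⟩
      · have hagree : Set.EqOn (Function.update c x y) c T := by
          intro a ha
          have : a ≠ x := by rintro rfl; exact hx ha
          simp [this]
        rw [Finset.coe_insert, Set.injOn_insert (by simpa using hx)]
        refine ⟨hc.congr hagree.symm, ?_⟩
        rw [hagree.image_eq, Function.update_self]
        simpa using hyT
      · intro a ha
        by_cases hax : a = x
        · subst hax; simpa using hy
        · rw [Function.update_of_ne hax]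
          exact hcs a ((Finset.mem_insert.1 ha).resolve_left hax)
  obtain ⟨c, hc, hcs⟩ := this Finset.univ
  exact ⟨c, by simpa using hc, fun a => hcs a (Finset.mem_univ a)⟩

namespace HypMet

lemma exists_pow_zpowers {H : Type*} [Group H] {g c : H} {T : Set H} (hT : T.Finite)
    (hET : ∀ w ∈ E g, ∃ j : ℤ, ∃ t ∈ T, w = g ^ j * t) (hc : c ∈ E g) :
    ∃ k : ℕ, 0 < k ∧ ∃ l : ℤ, c ^ k = g ^ l := by
  choose! j t ht he using hET
  have hmaps : Set.MapsTo (fun n : ℕ => t (c ^ n)) Set.univ T :=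
    fun n _ => ht _ (pow_mem hc n)
  obtain ⟨m, -, n, -, hmn, e⟩ := Set.infinite_univ.exists_lt_map_eq_of_mapsTo hmaps hT
  refine ⟨n - m, by omega, j (c ^ n) - j (c ^ m), ?_⟩
  have e1 := he _ (pow_mem hc n)
  have e2 := he _ (pow_mem hc m)
  have e3 : c ^ (n - m) = c ^ n * (c ^ m)⁻¹ := pow_sub c hmn.le
  rw [e3, zpow_sub]
  conv_lhs => rw [e1, e2, e]
  group

lemma conj_mem_E {H : Type*} [Group H] {g x : H} (hg : ¬ IsOfFinOrder g) {k : ℕ} (hk : 0 < k)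
    {l : ℤ} (e : (x * g * x⁻¹) ^ k = g ^ l) : x ∈ E g := by
  refine ⟨k, l, by omega, ?_, ?_⟩
  · rintro rfl
    rw [conj_pow, zpow_zero, mul_inv_eq_one, mul_eq_left] at e
    exact hg (isOfFinOrder_iff_pow_eq_one.2 ⟨k, hk, e⟩)
  · rw [← e, conj_pow, zpow_natCast]

theorem comm_case {H : Type*} [Group H] (hfg : Group.FG H)
    (htf : ∀ c : H, c ≠ 1 → ¬ IsOfFinOrder c) {d : H → H → ℤ} {D : ℤ} (h : HypMet H d D)
    (g : H) (hgF : g ∈ frattini H) (hg1 : g ≠ 1) (a : ℤ) (hQ : Q d g a)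
    (hfin : ((fun f : H => (f : H ⧸ E g)) '' (frattini H : Set H)).Finite) : False := by
  have hg := htf g hg1
  obtain ⟨T, hT, hET⟩ := h.E_finite hg hQ
  have hpow : ∀ f ∈ frattini H, ∃ n : ℕ, 0 < n ∧ f ^ n ∈ E g := by
    intro f hf
    have hmaps : Set.MapsTo (fun n : ℕ => ((f ^ n : H) : H ⧸ E g)) Set.univ
        ((fun f : H => (f : H ⧸ E g)) '' (frattini H : Set H)) :=
      fun n _ => ⟨f ^ n, pow_mem hf n, rfl⟩
    obtain ⟨m, -, n, -, hmn, e⟩ := Set.infinite_univ.exists_lt_map_eq_of_mapsTo hmaps hfin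
    refine ⟨n - m, by omega, ?_⟩
    have := QuotientGroup.eq.1 e
    have e2 : f ^ (n - m) = (f ^ m)⁻¹ * f ^ n := by
      rw [eq_inv_mul_iff_mul_eq, ← pow_add]; congr 1; omega
    rwa [e2]
  have hconj : ∀ x : H, x * g * x⁻¹ ∈ frattini H := fun x =>
    Subgroup.Normal.conj_mem inferInstance g hgF x
  have hall : ∀ x : H, x ∈ E g := by
    intro x
    obtain ⟨n, hn, hnE⟩ := hpow _ (hconj x)
    obtain ⟨k, hk, l, hkl⟩ := exists_pow_zpowers hT hET hnE
    rw [← pow_mul] at hkl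
    exact conj_mem_E hg (Nat.mul_pos hn hk) hkl
  have hfi : (Subgroup.zpowers g).FiniteIndex := by
    have : Finite (H ⧸ Subgroup.zpowers g) := by
      choose! j t ht he using hET
      have := hT.to_subtype
      refine Finite.of_injective
        (fun q : H ⧸ Subgroup.zpowers g => (⟨t (q.out)⁻¹, ht _ (hall _)⟩ : T)) ?_
      intro q1 q2 e
      have e' : t (q1.out)⁻¹ = t (q2.out)⁻¹ := congrArg Subtype.val e
      rw [← q1.out_eq', ← q2.out_eq']
      refine QuotientGroup.eq.2 ?_
      have e1 := he _ (hall (q1.out)⁻¹)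
      have e2 := he _ (hall (q2.out)⁻¹)
      have e3 : q2.out = ((q2.out)⁻¹)⁻¹ := (inv_inv _).symm
      rw [e3, e1, e2, e', Subgroup.mem_zpowers_iff]
      refine ⟨j (q1.out)⁻¹ - j (q2.out)⁻¹, ?_⟩
      rw [zpow_sub]
      group
    exact Subgroup.finiteIndex_of_finite_quotient
  have hcomm := comm_of_virt_cyclic htf g hfi
  have := @frattini_comm H { ‹Group H› with mul_comm := hcomm } hfg htf
  have hb : frattini H = ⊥ := this
  rw [hb, Subgroup.mem_bot] at hgF
  exact hg1 hgF

theorem pingpong_case {H : Type*} [Group H] (hfg : Group.FG H)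
    (htf : ∀ c : H, c ≠ 1 → ¬ IsOfFinOrder c) {d : H → H → ℤ} {D : ℤ} (h : HypMet H d D)
    (g : H) (hgF : g ∈ frattini H) (hg1 : g ≠ 1) (a : ℤ) (hQ : Q d g a)
    (hinf : ((fun f : H => (f : H ⧸ E g)) '' (frattini H : Set H)).Infinite) : False := by
  classical
  have hg := htf g hg1
  have hD := h.nn
  have := isCoatomic_subgroup_of_fg hfg
  obtain ⟨_, S, -, hS⟩ := Group.fg_iff'.1 hfg
  -- choose coset representatives
  let X : S × Bool → Set (H ⧸ E g) := fun a =>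
    (fun f : H => (((if a.2 then (a.1 : H) else 1) * f : H) : H ⧸ E g)) '' (frattini H : Set H)
  have hX : ∀ a, (X a).Infinite := by
    intro a
    have : X a = (fun q : H ⧸ E g => (if a.2 then (a.1 : H) else 1) • q) ''
        ((fun f : H => (f : H ⧸ E g)) '' (frattini H : Set H)) := by
      rw [Set.image_image]; rfl
    rw [this]
    exact hinf.image (MulAction.injective _).injOn
  obtain ⟨c, hcinj, hc⟩ := exists_inj_choice X hX
  choose f hf hfc using hc
  let r : S × Bool → H := fun a => (if a.2 then (a.1 : H) else 1) * f a
  have hr : ∀ a b, a ≠ b → (r a)⁻¹ * r b ∉ E g := by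
    intro a b hab hmem
    apply hab
    apply hcinj
    rw [← hfc a, ← hfc b]
    exact QuotientGroup.eq.2 hmem
  -- uniform bounds
  obtain ⟨M, hM⟩ : ∃ M, ∀ a, d 1 (r a) ≤ M := by
    obtain ⟨M, hM⟩ := (Set.finite_range (fun a => d 1 (r a))).bddAbove
    exact ⟨M, fun a => hM ⟨a, rfl⟩⟩
  have hB : ∀ p : (S × Bool) × (S × Bool), ∃ B, p.1 ≠ p.2 → ∀ n m : ℤ,
      d 1 (g ^ n) + d 1 ((r p.1)⁻¹ * r p.2 * g ^ m) - d (g ^ n) ((r p.1)⁻¹ * r p.2 * g ^ m) ≤ B := by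
    intro p
    by_cases hp : p.1 = p.2
    · exact ⟨0, fun h => absurd hp h⟩
    · obtain ⟨B, hB⟩ := h.gp_bounded hg hQ _ (hr _ _ hp)
      exact ⟨B, fun _ => hB⟩
  choose B0 hB0 using hB
  obtain ⟨B, hB⟩ : ∃ B, ∀ p, B0 p ≤ B := by
    obtain ⟨M, hM⟩ := (Set.finite_range B0).bddAbove
    exact ⟨M, fun a => hM ⟨a, rfl⟩⟩
  obtain ⟨N, hN0, hN⟩ := h.exists_far hg (2 * |B| + 20 * |M| + 2 * D + d 1 g)
  have hNm : d 1 (g ^ (-(N : ℤ))) = d 1 (g ^ N) := by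
    rw [zpow_neg, h.d_inv, zpow_natCast]
  let ε : Bool → ℤ := fun b => if b then N else -N
  have hε : ∀ b, d 1 (g ^ ε b) = d 1 (g ^ N) := by
    intro b
    cases b
    · exact hNm
    · simp [ε]
  let W : S × Bool → H := fun a => r a * g ^ (ε a.2) * (r (a.1, !a.2))⁻¹
  have hWinv : ∀ i b, W (i, !b) = (W (i, b))⁻¹ := by
    intro i b
    have : ε (!b) = - ε b := by cases b <;> simp [ε]
    simp only [W, Bool.not_not, this, zpow_neg]
    group
  have aB := le_abs_self B
  have aB0 := abs_nonneg B
  have aM := le_abs_self M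
  have aM0 := abs_nonneg M
  have hWd : ∀ a, d (r a * g ^ (ε a.2)) (W a) ≤ M := by
    intro a
    simp only [W]
    rw [h.d_mul, h.d_inv]
    exact hM _
  have hWA : ∀ a b, a ≠ b → d 1 (W a) + d 1 (W b) - d (W a) (W b) ≤ |B| + 8 * |M| := by
    intro a b hab
    have k := hB0 (a, b) hab (ε a.2) (ε b.2)
    have k' := hB (a, b)
    simp only at k
    have w1 := hWd a
    have w2 := hWd b
    set x := r a * g ^ (ε a.2)
    set y := r b * g ^ (ε b.2) with hy
    have e1 : d (g ^ ε a.2) ((r a)⁻¹ * r b * g ^ ε b.2) = d x y := by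
      rw [← h.inv (r a)]
      congr 1
      rw [hy]; group
    have e2 : d 1 ((r a)⁻¹ * r b * g ^ ε b.2) = d (r a) y := by
      rw [← h.one_inv_mul (r a) y]
      congr 1
      rw [hy]; group
    have e3 : d 1 (g ^ ε a.2) = d (r a) x := (h.d_mul _ _).symm
    rw [e1, e2, e3] at k
    have m1 := hM a
    have t1 := h.tri 1 (r a) x
    have t2 := h.tri 1 (r a) y
    have t3 := h.tri 1 x (W a)
    have t4 := h.tri 1 y (W b)
    have t5 := h.tri x (W a) y
    have t6 := h.tri (W a) (W b) y
    have t7 := h.comm y (W b)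
    omega
  have hWl : ∀ a, d 1 (g ^ N) - 2 * |M| ≤ d 1 (W a) := by
    intro a
    have w1 := hWd a
    have m1 := hM a
    have e3 : d 1 (g ^ ε a.2) = d (r a) (r a * g ^ (ε a.2)) := (h.d_mul _ _).symm
    rw [hε] at e3
    have t1 := h.tri (r a) 1 (r a * g ^ (ε a.2))
    have t2 := h.tri 1 (W a) (r a * g ^ (ε a.2))
    have c1 := h.comm (r a) 1
    have c2 := h.comm (W a) (r a * g ^ (ε a.2))
    omega
  have hpg := h.pos 1 g
  have hlong := h.word_long W (|B| + 8 * |M|) hWinv hWA (fun a => by have := hWl a; omega)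
  -- the new elements generate
  let u : S → H := fun s => W (s, true)
  have hgen : Subgroup.closure (Set.range u) = ⊤ := by
    apply frattini_nongenerating
    rw [eq_top_iff, ← hS, Subgroup.closure_le]
    intro s hs
    let s' : S := ⟨s, hs⟩
    have e : s = u s' * (f (s', true) * g ^ (N : ℤ) * (f (s', false))⁻¹)⁻¹ := by
      simp only [u, W, r, ε, s']
      simp
    rw [e]
    apply mul_mem
    · exact (le_sup_left : _ ≤ Subgroup.closure (Set.range u) ⊔ frattini H)
        (Subgroup.subset_closure ⟨s', rfl⟩)
    · apply (le_sup_right : _ ≤ Subgroup.closure (Set.range u) ⊔ frattini H)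
      exact inv_mem (mul_mem (mul_mem (hf _) (zpow_mem hgF _)) (inv_mem (hf _)))
  have hgmem : g ∈ (FreeGroup.lift u).range := by
    rw [FreeGroup.range_lift_eq_closure, hgen]; trivial
  obtain ⟨x, hx⟩ := hgmem
  have hred : FreeGroup.IsReduced x.toWord := FreeGroup.isReduced_toWord
  have hprod : (x.toWord.map W).prod = g := by
    rw [← hx]
    conv_rhs => rw [← FreeGroup.mk_toWord (x := x), FreeGroup.lift_mk]
    congr 1
    apply List.map_congr_left
    rintro ⟨i, b⟩ -
    cases b
    · exact hWinv i true
    · rfl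
  rcases hL : x.toWord with _ | ⟨b, L⟩
  · rw [hL] at hprod
    exact hg1 (by simpa using hprod.symm)
  · rw [hL] at hprod hred
    have k := hlong L b hred
    rw [hprod] at k
    have k2 := hWl b
    have t := h.tri 1 g (W b)
    have t' := h.comm g (W b)
    omega

theorem frattini_eq_bot {H : Type*} [Group H] (hfg : Group.FG H)
    (htf : ∀ c : H, c ≠ 1 → ¬ IsOfFinOrder c) {d : H → H → ℤ} {D : ℤ} (h : HypMet H d D)
    (hQex : ∀ g : H, g ≠ 1 → ∃ k : ℕ, 0 < k ∧ ∃ a, Q d (g ^ k) a) : frattini H = ⊥ := by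
  rw [eq_bot_iff]
  intro g0 hg0
  by_contra hne
  obtain ⟨k, hk, a, hQ⟩ := hQex g0 hne
  have h1 : g0 ^ k ≠ 1 := fun e => htf g0 hne (isOfFinOrder_iff_pow_eq_one.2 ⟨k, hk, e⟩)
  have hF : g0 ^ k ∈ frattini H := pow_mem hg0 k
  by_cases hfin : ((fun f : H => (f : H ⧸ E (g0 ^ k))) '' (frattini H : Set H)).Finite
  · exact comm_case hfg htf h _ hF h1 a hQ hfin
  · exact pingpong_case hfg htf h _ hF h1 a hQ hfin

end HypMet

section WordMetric

variable {C : Type*} [Group C] {S : Set C}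

lemma wordLength_le (l : List C) (hl : ∀ x ∈ l, x ∈ S ∨ x⁻¹ ∈ S) :
    wordLength S l.prod ≤ l.length := Nat.sInf_le ⟨l, rfl, hl, rfl⟩

lemma wordLength_spec (hS : Subgroup.closure S = ⊤) (g : C) :
    ∃ l : List C, l.length = wordLength S g ∧ (∀ x ∈ l, x ∈ S ∨ x⁻¹ ∈ S) ∧ l.prod = g := by
  have hne : {n : ℕ | ∃ l : List C, l.length = n ∧ (∀ x ∈ l, x ∈ S ∨ x⁻¹ ∈ S) ∧
      l.prod = g}.Nonempty := by
    have hg : g ∈ Subgroup.closure S := by rw [hS]; trivial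
    rw [← Subgroup.mem_toSubmonoid, Subgroup.closure_toSubmonoid] at hg
    obtain ⟨l, hl, hp⟩ := Submonoid.exists_list_of_mem_closure hg
    exact ⟨l.length, l, rfl, hl, hp⟩
  exact Nat.sInf_mem hne

lemma wordLength_mul (hS : Subgroup.closure S = ⊤) (x y : C) :
    wordLength S (x * y) ≤ wordLength S x + wordLength S y := by
  obtain ⟨l, hl, hl', rfl⟩ := wordLength_spec hS x
  obtain ⟨m, hm, hm', rfl⟩ := wordLength_spec hS y
  rw [← hl, ← hm, ← List.prod_append, ← List.length_append]
  apply wordLength_le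
  intro z hz
  rcases List.mem_append.1 hz with hz | hz
  · exact hl' z hz
  · exact hm' z hz

lemma wordLength_inv_le (hS : Subgroup.closure S = ⊤) (x : C) :
    wordLength S x⁻¹ ≤ wordLength S x := by
  obtain ⟨l, hl, hl', rfl⟩ := wordLength_spec hS x
  rw [List.prod_inv_reverse, ← hl]
  refine (wordLength_le _ ?_).trans (by simp)
  intro z hz
  simp only [List.mem_reverse, List.mem_map] at hz
  obtain ⟨y, hy, rfl⟩ := hz
  rw [inv_inv]
  exact (hl' y hy).symm

lemma wordLength_inv (hS : Subgroup.closure S = ⊤) (x : C) :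
    wordLength S x⁻¹ = wordLength S x := by
  apply le_antisymm (wordLength_inv_le hS x)
  have := wordLength_inv_le hS x⁻¹
  rwa [inv_inv] at this

lemma wordLength_one : wordLength S (1 : C) = 0 := by
  have := wordLength_le (S := S) [] (by simp)
  simpa using this

lemma wordLength_ball (hS : Subgroup.closure S = ⊤) (hf : S.Finite) (n : ℕ) :
    {x : C | wordLength S x ≤ n}.Finite := by
  have hS' : (S ∪ S⁻¹).Finite := hf.union hf.inv
  have := hS'.to_subtype
  have hfin : {l : List (S ∪ S⁻¹ : Set C) | l.length ≤ n}.Finite := List.finite_length_le _ n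
  refine (hfin.image (fun l => (l.map Subtype.val).prod)).subset ?_
  intro x hx
  obtain ⟨l, hl, hl', rfl⟩ := wordLength_spec hS x
  have hl'' : ∀ x ∈ l, x ∈ S ∪ S⁻¹ := hl'
  refine ⟨l.attach.map (fun y => ⟨y.1, hl'' y.1 y.2⟩), ?_, ?_⟩
  · simp only [Set.mem_ofPred_eq, List.length_map, List.length_attach]
    rw [hl]; exact hx
  · simp [List.map_map, Function.comp_def]

lemma wordDist_hypMet (hS : Subgroup.closure S = ⊤) (hf : S.Finite) {δ : ℝ} (hδ : 0 ≤ δ)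
    (h4 : GromovFourPoint S δ) :
    HypMet C (fun x y => (wordDist S x y : ℤ)) ⌈2 * δ⌉ where
  inv g x y := by
    simp only [wordDist]; congr 2; group
  self x := by simp [wordDist, wordLength_one]
  comm x y := by
    have : y⁻¹ * x = (x⁻¹ * y)⁻¹ := by group
    simp only [wordDist]
    rw [this, wordLength_inv hS]
  tri x y z := by
    have : x⁻¹ * z = (x⁻¹ * y) * (y⁻¹ * z) := by group
    have h2 := wordLength_mul hS (x⁻¹ * y) (y⁻¹ * z)
    rw [← this] at h2
    simp only [wordDist]
    exact_mod_cast h2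
  hyp x y z w := by
    have h5 := h4 x y z w
    have hc := Int.le_ceil (2 * δ)
    rcases le_total ((wordDist S x z : ℝ) + (wordDist S y w : ℝ))
          ((wordDist S x w : ℝ) + (wordDist S y z : ℝ)) with hle | hle
    · right
      rw [max_eq_right hle] at h5
      have : ((wordDist S x y : ℝ) + wordDist S z w) ≤
        (wordDist S x w + wordDist S y z) + (⌈2 * δ⌉ : ℤ) := by linarith
      exact_mod_cast this
    · left
      rw [max_eq_left hle] at h5
      have : ((wordDist S x y : ℝ) + wordDist S z w) ≤
        (wordDist S x z + wordDist S y w) + (⌈2 * δ⌉ : ℤ) := by linarith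
      exact_mod_cast this
  fin R := by
    refine (wordLength_ball hS hf R.toNat).subset ?_
    intro x hx
    simp only [Set.mem_ofPred_eq, wordDist, inv_one, one_mul] at hx ⊢
    omega
  nn := Int.ceil_nonneg (by linarith)

lemma wordDist_geo (hS : Subgroup.closure S = ⊤) (x : C) (r : ℤ) (h0 : 0 ≤ r)
    (hr : r ≤ (wordDist S 1 x : ℤ)) :
    ∃ m, (wordDist S 1 m : ℤ) = r ∧ (wordDist S m x : ℤ) = (wordDist S 1 x : ℤ) - r := by
  lift r to ℕ using h0
  obtain ⟨l, hl, hl', rfl⟩ := wordLength_spec hS x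
  have e : l.prod = (l.take r).prod * (l.drop r).prod := by
    rw [← List.prod_append, List.take_append_drop]
  simp only [wordDist, inv_one, one_mul] at hr ⊢
  refine ⟨(l.take r).prod, ?_⟩
  have e2 : (l.take r).prod⁻¹ * l.prod = (l.drop r).prod := by rw [e]; group
  rw [e2]
  have h1 := wordLength_le (S := S) (l.take r) (fun x hx => hl' x (List.mem_of_mem_take hx))
  have h2 := wordLength_le (S := S) (l.drop r) (fun x hx => hl' x (List.mem_of_mem_drop hx))
  have h3 := wordLength_mul hS (l.take r).prod (l.drop r).prod
  rw [← e] at h3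
  rw [List.length_take] at h1
  rw [List.length_drop] at h2
  omega

end WordMetric

/-- Corollary B: a finitely generated group which is residually
torsion-free word-hyperbolic has trivial Frattini subgroup. -/
theorem frattini_eq_bot_of_residually_torsionfree_hyperbolic {G : Type*} [Group G]
    (hfg : Group.FG G)
    (hres : ∀ g : G, g ≠ 1 → ∃ (C : Type) (_ : Group C),
      IsWordHyperbolic C ∧ (∀ c : C, c ≠ 1 → ¬IsOfFinOrder c) ∧
      ∃ φ : G →* C, φ g ≠ 1) :
    frattini G = ⊥ := by
  rw [eq_bot_iff]
  intro g hg
  by_contra hne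
  obtain ⟨C, _, ⟨S, hS, δ, hδ, h4⟩, htf, φ, hφ⟩ := hres g hne
  have hm := wordDist_hypMet hS S.finite_toSet hδ h4
  have htf' : ∀ c : φ.range, c ≠ 1 → ¬ IsOfFinOrder c := by
    intro c hc hfo
    apply htf (c : C)
    · intro e; exact hc (Subtype.ext e)
    · exact MonoidHom.isOfFinOrder φ.range.subtype hfo
  have hfg' : Group.FG φ.range :=
    have := hfg
    Group.fg_of_surjective φ.rangeRestrict_surjective
  have hm' : HypMet φ.range (fun x y => (wordDist (S : Set C) (x : C) (y : C) : ℤ)) ⌈2 * δ⌉ :=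
    { inv := fun g x y => hm.inv g x y
      self := fun x => hm.self x
      comm := fun x y => hm.comm x y
      tri := fun x y z => hm.tri x y z
      hyp := fun x y z w => hm.hyp x y z w
      fin := fun R => by
        have := Set.Finite.preimage (f := (Subtype.val : φ.range → C)) Subtype.val_injective.injOn (hm.fin R)
        exact this
      nn := hm.nn }
  have hb := HypMet.frattini_eq_bot hfg' htf' hm' (by
    intro x hx
    obtain ⟨k, hk, a, ha⟩ := hm.exists_Q (wordDist_geo hS) (x : C)
      (htf (x : C) (fun e => hx (Subtype.ext e)))
    exact ⟨k, hk, a, fun i j l hij hjl => by simpa using ha i j l hij hjl⟩)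
  have h1 := frattini_le_comap_frattini_of_surjective φ.rangeRestrict_surjective hg
  rw [hb, Subgroup.mem_comap, Subgroup.mem_bot] at h1
  exact hφ (congrArg Subtype.val h1)
end

section
/- Proposition 2.2(1): Let G be a word-hyperbolic group and let g ∈ G be an element of infinite order. If h⁻¹gⁿh = g^m for some integers m, n and some h ∈ G, then |m| = |n|. -/
/-- A commuting almost-isometry that is not loxodromic moves the middle point little. -/
theorem aux_center {G : Type*} [Group G] (d : G → G → ℝ) (δ : ℝ) (hδ : 0 ≤ δ)
    (hinv : ∀ a x y, d (a * x) (a * y) = d x y) (hsymm : ∀ x y, d x y = d y x)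
    (htri : ∀ x y z, d x z ≤ d x y + d y z)
    (hfp : ∀ x y z w, d x y + d z w ≤ max (d x z + d y w) (d x w + d y z) + 2 * δ)
    (u q p : G) (R : ℝ) (hR : 0 ≤ R) (hu : d 1 u ≤ R) (hcomm : u * q = q * u)
    (hp : d 1 p + d p q = d 1 q)
    (ha : 10 * R + 100 * δ + 1 ≤ d 1 p) (hb : 10 * R + 100 * δ + 1 ≤ d p q)
    (hnl : d p (u * (u * p)) ≤ d p (u * p) + 2 * δ) :
    d p (u * p) ≤ 16 * δ := by
  have e1 : d u (u * p) = d 1 p := by simpa using hinv u 1 p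
  have e2 : d (u * p) (u * q) = d p q := hinv u p q
  have e3 : d u (u * q) = d 1 q := by simpa using hinv u 1 q
  have e4 : d q (u * q) = d 1 u := by rw [hcomm]; simpa using hinv q 1 u
  have e5 : d (u * p) (u * (u * p)) = d p (u * p) := hinv u p (u * p)
  have e6 : d u (u * (u * p)) = d 1 (u * p) := by simpa using hinv u 1 (u * p)
  generalize u * (u * p) = w at *
  generalize u * p = v at *
  generalize u * q = q' at *
  have s1 := hsymm u 1
  have s2 := hsymm q q'
  have s3 := hsymm p v
  have s4 := hsymm v q
  have s5 := hsymm v q'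
  have s6 := hsymm v w
  have s7 := hsymm p 1
  have s8 := hsymm q' 1
  have s9 := hsymm v u
  have s10 := hsymm v 1
  have s11 := hsymm w u
  have s12 := hsymm w 1
  have t1 := htri 1 u v
  have t2 := htri u 1 v
  have t3 := htri q q' v
  have t4 := htri q' q v
  have f1 := hfp u q' 1 v
  have f2 := hfp 1 q' q v
  have k1 : d 1 q' + d u v ≥ d u q' + d 1 v - 2 * δ := by
    rcases max_cases (d u 1 + d q' v) (d u v + d q' 1) with h | h <;> linarith
  have k2 : d 1 v + d v q ≤ d 1 q + 4 * δ := by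
    rcases max_cases (d 1 q + d q' v) (d 1 v + d q' q) with h | h <;> linarith
  have f3 := hfp p v 1 q
  have t5 := htri 1 v q
  have k3 : d p v ≤ |d 1 v - d 1 p| + 6 * δ := by
    have := le_abs_self (d 1 v - d 1 p)
    have := neg_abs_le (d 1 v - d 1 p)
    rcases max_cases (d p 1 + d v q) (d p q + d v 1) with h | h <;> linarith
  have k4 : |d 1 v - d 1 p| ≤ R := abs_le.2 ⟨by linarith, by linarith⟩
  have f4 := hfp 1 w u v
  have f5 := hfp 1 v u w
  have t6 := htri 1 p w
  have t7 := htri 1 w p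
  have t8 := htri 1 v w
  have t9 := htri 1 w v
  have s13 := hsymm p w
  have k5 : d 1 w + d u v ≤ d 1 v + d u w + 2 * δ := by
    rcases max_cases (d 1 u + d w v) (d 1 v + d w u) with h | h <;> linarith
  have k6 : d 1 v + d u w ≤ d 1 w + d u v + 2 * δ := by
    rcases max_cases (d 1 u + d v w) (d 1 w + d v u) with h | h <;> linarith
  rcases abs_cases (d 1 v - d 1 p) with h | h <;> linarith

/-- Linear growth of powers when `|f²| > |f| + 2δ`. -/
theorem aux_growth {G : Type*} [Group G] (d : G → G → ℝ) (δ : ℝ)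
    (hinv : ∀ a x y, d (a * x) (a * y) = d x y) (hsymm : ∀ x y, d x y = d y x)
    (h0 : ∀ x, d x x = 0) (hnn : ∀ x y, 0 ≤ d x y)
    (hδ : 0 ≤ δ)
    (hfp : ∀ x y z w, d x y + d z w ≤ max (d x z + d y w) (d x w + d y z) + 2 * δ)
    (f : G) (ε : ℝ) (hε : 0 < ε) (hf : d 1 f + 2 * δ + ε ≤ d 1 (f ^ 2)) (hf1 : ε ≤ d 1 f) (n : ℕ) :
    n * ε ≤ d 1 (f ^ n) := by
  have step : ∀ n : ℕ, d 1 (f ^ n) + ε ≤ d 1 (f ^ (n + 1)) := by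
    intro n
    induction n with
    | zero => simpa [h0] using hf1
    | succ n ih =>
      have e1 : d f (f ^ (n + 2)) = d 1 (f ^ (n + 1)) := by
        have := hinv f 1 (f ^ (n + 1))
        rwa [mul_one, ← pow_succ'] at this
      have e2 : d (f ^ 2) (f ^ (n + 2)) = d 1 (f ^ n) := by
        have := hinv (f ^ 2) 1 (f ^ n)
        rwa [mul_one, ← pow_add, add_comm 2 n] at this
      have e3 : d f (f ^ 2) = d 1 f := by
        have := hinv f 1 f
        rwa [mul_one, ← pow_two] at this
      have s1 := hsymm (f ^ 2) f
      have := hfp 1 (f ^ 2) f (f ^ (n + 2))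
      show _ ≤ d 1 (f ^ (n + 2))
      rcases max_cases (d 1 f + d (f ^ 2) (f ^ (n + 2))) (d 1 (f ^ (n + 2)) + d (f ^ 2) f)
        with h | h <;> linarith
  induction n with
  | zero => simp [h0]
  | succ n ih => have := step n; push_cast; linarith

theorem aux_nonlox {G : Type*} [Group G] (d : G → G → ℝ) (δ : ℝ)
    (hinv : ∀ a x y, d (a * x) (a * y) = d x y) (hsymm : ∀ x y, d x y = d y x)
    (htri : ∀ x y z, d x z ≤ d x y + d y z)
    (h0 : ∀ x, d x x = 0) (hnn : ∀ x y, 0 ≤ d x y)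
    (hδ : 0 ≤ δ)
    (hfp : ∀ x y z w, d x y + d z w ≤ max (d x z + d y w) (d x w + d y z) + 2 * δ)
    (f h : G) (m n : ℤ) (hm : m ≠ 0) (hn : n ≠ 0) (hmn : |m| ≠ |n|)
    (hconj : h⁻¹ * f ^ n * h = f ^ m) :
    d 1 (f ^ 2) ≤ d 1 f + 2 * δ := by
  by_contra hcon
  push Not at hcon
  have hmulL : ∀ a b, d 1 (a * b) ≤ d 1 a + d 1 b := by
    intro a b
    have := htri 1 a (a * b)
    have e := hinv a 1 b
    rw [mul_one] at e
    linarith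
  have hinvL : ∀ a, d 1 a⁻¹ = d 1 a := by
    intro a
    have e := hinv a 1 a⁻¹
    rw [mul_one, mul_inv_cancel] at e
    rw [← e, hsymm]
  have hf2 : d 1 (f ^ 2) ≤ d 1 f + d 1 f := by rw [pow_two]; exact hmulL f f
  obtain ⟨ε, hε, hε1⟩ : ∃ ε : ℝ, 0 < ε ∧ d 1 f + 2 * δ + ε ≤ d 1 (f ^ 2) :=
    ⟨d 1 (f ^ 2) - (d 1 f + 2 * δ), by linarith, by linarith⟩
  have hgrow := aux_growth d δ hinv hsymm h0 hnn hδ hfp f ε hε hε1 (by linarith)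
  have hsub : Subadditive (fun k : ℕ => d 1 (f ^ k)) := by
    intro a b
    simp only [pow_add]
    exact hmulL _ _
  have hbdd : BddBelow (Set.range fun k : ℕ => d 1 (f ^ k) / k) :=
    ⟨0, by rintro _ ⟨k, rfl⟩; exact div_nonneg (hnn _ _) (Nat.cast_nonneg _)⟩
  have hlim := hsub.tendsto_lim hbdd
  set τ := hsub.lim with hτ
  have hτpos : ε ≤ τ := by
    refine ge_of_tendsto hlim ?_
    filter_upwards [Filter.eventually_gt_atTop 0] with k hk
    rw [le_div_iff₀ (by exact_mod_cast hk)]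
    linarith [hgrow k]
  have habs : ∀ z : ℤ, d 1 (f ^ z) = d 1 (f ^ z.natAbs) := by
    intro z
    rcases Int.natAbs_eq z with hz | hz
    · conv_lhs => rw [hz, zpow_natCast]
    · conv_lhs => rw [hz, zpow_neg, zpow_natCast, hinvL]
  have hscale : ∀ z : ℤ, z ≠ 0 →
      Filter.Tendsto (fun k : ℕ => d 1 (f ^ (z * k)) / k) Filter.atTop
        (nhds (z.natAbs * τ)) := by
    intro z hz
    have hz' : 0 < z.natAbs := Int.natAbs_pos.2 hz
    have h1 : Filter.Tendsto (fun k : ℕ => z.natAbs * k) Filter.atTop Filter.atTop :=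
      Filter.tendsto_id.const_mul_atTop' hz'
    have h2 := (hlim.comp h1).const_mul (z.natAbs : ℝ)
    refine h2.congr ?_
    intro k
    have hz2 : (z.natAbs : ℝ) ≠ 0 := by exact_mod_cast hz'.ne'
    rw [habs (z * k), Int.natAbs_mul, Int.natAbs_natCast]
    simp only [Function.comp]
    rw [Nat.cast_mul, ← mul_div_assoc, mul_div_mul_left _ _ hz2]
  have hpow : ∀ k : ℕ, h⁻¹ * f ^ (n * k) * h = f ^ (m * k) := by
    intro k
    rw [zpow_mul, zpow_mul, ← hconj, zpow_natCast, zpow_natCast]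
    have := conj_pow (i := k) (a := h⁻¹) (b := f ^ n)
    rw [inv_inv] at this
    exact this.symm
  have hd := (hscale m hm).sub (hscale n hn)
  have hz : Filter.Tendsto (fun k : ℕ => d 1 (f ^ (m * k)) / k - d 1 (f ^ (n * k)) / k)
      Filter.atTop (nhds 0) := by
    refine squeeze_zero_norm (a := fun k : ℕ => (2 * d 1 h) / (k : ℝ)) ?_
      (tendsto_const_div_atTop_nhds_zero_nat _)
    intro k
    rw [Real.norm_eq_abs, ← sub_div, abs_div, Nat.abs_cast]
    refine div_le_div_of_nonneg_right ?_ (Nat.cast_nonneg _)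
    have e : f ^ (n * (k : ℤ)) = h * f ^ (m * (k : ℤ)) * h⁻¹ := by rw [← hpow k]; group
    have a1 := hmulL (h⁻¹ * f ^ (n * (k : ℤ))) h
    have a2 := hmulL h⁻¹ (f ^ (n * (k : ℤ)))
    have a3 := hmulL (h * f ^ (m * (k : ℤ))) h⁻¹
    have a4 := hmulL h (f ^ (m * (k : ℤ)))
    rw [← e] at a3
    rw [hpow k] at a1
    have := hinvL h
    exact abs_le.2 ⟨by linarith, by linarith⟩
  have heq := tendsto_nhds_unique hd hz
  rw [← sub_mul] at heq
  rcases mul_eq_zero.1 heq with h1 | h1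
  · apply hmn
    have h2 : (m.natAbs : ℝ) = n.natAbs := by linarith
    have h3 : m.natAbs = n.natAbs := by exact_mod_cast h2
    rw [Int.abs_eq_natAbs, Int.abs_eq_natAbs, h3]
  · linarith

theorem aux_main {G : Type*} [Group G] (d : G → G → ℝ) (δ : ℝ)
    (hinv : ∀ a x y, d (a * x) (a * y) = d x y) (hsymm : ∀ x y, d x y = d y x)
    (htri : ∀ x y z, d x z ≤ d x y + d y z)
    (h0 : ∀ x, d x x = 0) (hnn : ∀ x y, 0 ≤ d x y)
    (hδ : 0 ≤ δ)
    (hfp : ∀ x y z w, d x y + d z w ≤ max (d x z + d y w) (d x w + d y z) + 2 * δ)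
    (hfin : ∀ r : ℝ, {x | d 1 x ≤ r}.Finite)
    (hmid : ∀ q, ∃ p, d 1 p + d p q = d 1 q ∧ |d 1 p - d p q| ≤ 1)
    (g h : G) (hg : ¬ IsOfFinOrder g) (m n : ℤ) (hm : m ≠ 0) (hn : n ≠ 0)
    (hconj : h⁻¹ * g ^ n * h = g ^ m) : |m| = |n| := by
  by_contra hmn
  have hginj : Function.Injective (fun k : ℕ => g ^ k) :=
    injective_pow_iff_not_isOfFinOrder.2 hg
  -- all conjugates of powers are not loxodromic
  have hnl : ∀ (i : ℕ) (p : G), d p (g ^ i * (g ^ i * p)) ≤ d p (g ^ i * p) + 2 * δ := by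
    intro i p
    have key := aux_nonlox d δ hinv hsymm htri h0 hnn hδ hfp (p⁻¹ * g ^ i * p) (p⁻¹ * h * p)
      m n hm hn hmn (by
        have hc : ∀ z : ℤ, (p⁻¹ * g ^ i * p) ^ z = p⁻¹ * (g ^ z) ^ i * p := by
          intro z
          have := conj_zpow (i := z) (a := p⁻¹) (b := g ^ i)
          rw [inv_inv] at this
          rw [this, ← zpow_natCast, ← zpow_natCast, ← zpow_mul, ← zpow_mul, mul_comm]
        have hh : h⁻¹ * (g ^ n) ^ i * h = (g ^ m) ^ i := by
          have := conj_pow (i := i) (a := h⁻¹) (b := g ^ n)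
          rw [inv_inv] at this
          rw [← this, hconj]
        rw [hc, hc, ← hh]
        group)
    have e1 := hinv p 1 ((p⁻¹ * g ^ i * p) ^ 2)
    have e2 := hinv p 1 (p⁻¹ * g ^ i * p)
    have w1 : p * (p⁻¹ * g ^ i * p) ^ 2 = g ^ i * (g ^ i * p) := by
      rw [pow_two]; simp [mul_assoc]
    have w2 : p * (p⁻¹ * g ^ i * p) = g ^ i * p := by simp [mul_assoc]
    rw [w1, mul_one] at e1
    rw [w2, mul_one] at e2
    linarith
  set B := (hfin (16 * δ)).toFinset with hB
  set N := B.card + 1 with hN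
  set R := ∑ i ∈ Finset.range N, d 1 (g ^ i) with hRdef
  have hR : 0 ≤ R := Finset.sum_nonneg fun i _ => hnn _ _
  have hRi : ∀ i ∈ Finset.range N, d 1 (g ^ i) ≤ R := fun i hi =>
    Finset.single_le_sum (f := fun i => d 1 (g ^ i)) (fun i _ => hnn _ _) hi
  obtain ⟨k, hk⟩ : ∃ k : ℕ, 2 * (10 * R + 100 * δ + 1) + 1 < d 1 (g ^ k) := by
    by_contra hcon
    push Not at hcon
    exact Set.infinite_range_of_injective hginj
      ((hfin (2 * (10 * R + 100 * δ + 1) + 1)).subset (by rintro _ ⟨k, rfl⟩; exact hcon k))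
  obtain ⟨p, hp1, hp2⟩ := hmid (g ^ k)
  have hp3 := abs_le.1 hp2
  have hsmall : ∀ i ∈ Finset.range N, p⁻¹ * g ^ i * p ∈ B := by
    intro i hi
    rw [hB, Set.Finite.mem_toFinset, Set.mem_ofPred_eq]
    have := aux_center d δ hδ hinv hsymm htri hfp (g ^ i) (g ^ k) p R hR (hRi i hi)
      (by rw [← pow_add, ← pow_add, add_comm]) hp1 (by linarith) (by linarith) (hnl i p)
    have e := hinv p⁻¹ p (g ^ i * p)
    rw [inv_mul_cancel, ← mul_assoc] at e
    linarith
  have hcard : B.card < (Finset.range N).card := by simp [hN]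
  obtain ⟨i, hi, j, hj, hij, he⟩ := Finset.exists_ne_map_eq_of_card_lt_of_maps_to hcard hsmall
  exact hij (hginj (by simpa using he))

section WordLength

variable {G : Type*} [Group G] (S : Set G)

theorem wl_le_of_list (l : List G) (hl : ∀ x ∈ l, x ∈ S ∨ x⁻¹ ∈ S) :
    wordLength S l.prod ≤ l.length :=
  Nat.sInf_le ⟨l, rfl, hl, rfl⟩

theorem wl_exists (hS : Subgroup.closure S = ⊤) (g : G) :
    ∃ l : List G, l.length = wordLength S g ∧ (∀ x ∈ l, x ∈ S ∨ x⁻¹ ∈ S) ∧ l.prod = g := by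
  have hne : {n : ℕ | ∃ l : List G, l.length = n ∧ (∀ x ∈ l, x ∈ S ∨ x⁻¹ ∈ S) ∧
      l.prod = g}.Nonempty := by
    obtain ⟨l, hl, hp⟩ := Submonoid.exists_list_of_mem_closure
      (show g ∈ Submonoid.closure (S ∪ S⁻¹) by
        rw [← Subgroup.closure_toSubmonoid, hS]; trivial)
    exact ⟨l.length, l, rfl, hl, hp⟩
  exact Nat.sInf_mem hne

theorem wl_one : wordLength S 1 = 0 := by
  have := wl_le_of_list S [] (by simp)
  simpa using this

theorem wl_mul (hS : Subgroup.closure S = ⊤) (a b : G) :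
    wordLength S (a * b) ≤ wordLength S a + wordLength S b := by
  obtain ⟨l, h1, h2, h3⟩ := wl_exists S hS a
  obtain ⟨l', h1', h2', h3'⟩ := wl_exists S hS b
  have := wl_le_of_list S (l ++ l') (by
    intro x hx
    rcases List.mem_append.1 hx with h | h
    · exact h2 x h
    · exact h2' x h)
  rw [List.prod_append, List.length_append, h3, h3', h1, h1'] at this
  exact this

theorem wl_inv_le (hS : Subgroup.closure S = ⊤) (a : G) :
    wordLength S a⁻¹ ≤ wordLength S a := by
  obtain ⟨l, h1, h2, h3⟩ := wl_exists S hS a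
  have := wl_le_of_list S (l.map (·⁻¹)).reverse (by
    intro x hx
    simp only [List.mem_reverse, List.mem_map] at hx
    obtain ⟨y, hy, rfl⟩ := hx
    rw [inv_inv]
    exact (h2 y hy).symm)
  rw [← List.prod_inv_reverse, h3, List.length_reverse, List.length_map, h1] at this
  exact this

theorem wl_inv (hS : Subgroup.closure S = ⊤) (a : G) :
    wordLength S a⁻¹ = wordLength S a :=
  le_antisymm (wl_inv_le S hS a) (by simpa using wl_inv_le S hS a⁻¹)

theorem wl_finite (hS : Subgroup.closure S = ⊤) (hfin : S.Finite) (r : ℕ) :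
    {x | wordLength S x ≤ r}.Finite := by
  have hT : (S ∪ S⁻¹).Finite := hfin.union hfin.inv
  have : Finite (S ∪ S⁻¹ : Set G) := hT
  have hL := List.finite_length_le (S ∪ S⁻¹ : Set G) r
  refine (hL.image (fun l => (l.map Subtype.val).prod)).subset ?_
  intro x hx
  obtain ⟨l, h1, h2, h3⟩ := wl_exists S hS x
  lift l to List (S ∪ S⁻¹ : Set G) using (by
    intro y hy
    exact h2 y hy)
  refine ⟨l, ?_, h3⟩
  rw [List.length_map] at h1
  show l.length ≤ r
  rw [h1]
  exact hx

theorem wl_mid (hS : Subgroup.closure S = ⊤) (q : G) :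
    ∃ p, wordLength S p + wordLength S (p⁻¹ * q) = wordLength S q ∧
      wordLength S p ≤ wordLength S (p⁻¹ * q) + 1 ∧
      wordLength S (p⁻¹ * q) ≤ wordLength S p + 1 := by
  obtain ⟨l, h1, h2, h3⟩ := wl_exists S hS q
  set k := l.length / 2 with hk
  have hq : (l.take k).prod * (l.drop k).prod = q := by rw [List.prod_take_mul_prod_drop, h3]
  have a1 := wl_le_of_list S (l.take k) (fun x hx => h2 x (List.mem_of_mem_take hx))
  have a2 := wl_le_of_list S (l.drop k) (fun x hx => h2 x (List.mem_of_mem_drop hx))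
  have a3 := wl_mul S hS (l.take k).prod (l.drop k).prod
  have e : (l.take k).prod⁻¹ * q = (l.drop k).prod := by rw [← hq]; group
  rw [hq] at a3
  rw [List.length_take] at a1
  rw [List.length_drop] at a2
  refine ⟨(l.take k).prod, ?_⟩
  rw [e]
  omega

end WordLength

/-- Proposition 2.2(1): if `g` has infinite order in a word-hyperbolic group and
`h⁻¹ gⁿ h = g^m`, then `|m| = |n|`. -/
theorem conj_zpow_eq_zpow_natAbs_eq {G : Type*} [Group G] (hG : IsWordHyperbolic G)
    (g : G) (hg : ¬IsOfFinOrder g) (h : G) (m n : ℤ)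
    (hconj : h⁻¹ * g ^ n * h = g ^ m) :
    |m| = |n| := by
  have hz : ∀ z : ℤ, g ^ z = 1 → z = 0 := by
    intro z hz
    by_contra hne
    exact hg (isOfFinOrder_iff_zpow_eq_one.2 ⟨z, hne, hz⟩)
  by_cases hn : n = 0
  · subst hn
    have : m = 0 := hz m (by rw [← hconj]; simp)
    simp [this]
  by_cases hm : m = 0
  · subst hm
    refine absurd (hz n ?_) hn
    have : g ^ n = h * (h⁻¹ * g ^ n * h) * h⁻¹ := by group
    rw [this, hconj]; simp
  obtain ⟨S, hS, δ, hδ, hfp⟩ := hG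
  refine aux_main (fun x y => (wordDist (S : Set G) x y : ℝ)) δ ?_ ?_ ?_ ?_ ?_ hδ hfp ?_ ?_
    g h hg m n hm hn hconj
  · intro a x y
    simp [wordDist, mul_assoc]
  · intro x y
    simp only [wordDist]
    rw [← wl_inv _ hS (x⁻¹ * y)]
    simp
  · intro x y z
    have := wl_mul _ hS (x⁻¹ * y) (y⁻¹ * z)
    rw [show x⁻¹ * y * (y⁻¹ * z) = x⁻¹ * z by group] at this
    simp only [wordDist]
    exact_mod_cast this
  · intro x
    simp [wordDist, wl_one]
  · intro x y
    exact Nat.cast_nonneg _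
  · intro r
    refine (wl_finite (S : Set G) hS S.finite_toSet ⌊r⌋₊).subset ?_
    intro x hx
    simp only [wordDist, Set.mem_ofPred_eq, inv_one, one_mul] at hx
    exact Nat.le_floor hx
  · intro q
    obtain ⟨p, h1, h2, h3⟩ := wl_mid (S : Set G) hS q
    refine ⟨p, ?_, ?_⟩
    · simp only [wordDist, inv_one, one_mul]
      exact_mod_cast h1
    · simp only [wordDist, inv_one, one_mul]
      have h2' : (wordLength (S : Set G) p : ℝ) ≤ wordLength (S : Set G) (p⁻¹ * q) + 1 := by
        exact_mod_cast h2
      have h3' : (wordLength (S : Set G) (p⁻¹ * q) : ℝ) ≤ wordLength (S : Set G) p + 1 := by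
        exact_mod_cast h3
      exact abs_le.2 ⟨by linarith, by linarith⟩
end

section
/- Let G be a word-hyperbolic group with finite generating set S witnessing hyperbolicity, let g ∈ G be an element of infinite order, and let c_1, …, c_t ∈ G be elements with c_j ∉ E(g) for each j = 1, …, t. Then for every real number R > 0 there exist positive integers n_1, …, n_t such that every nontrivial element w of the subgroup of G generated by {g^{n_j} c_j g^{10 n_j} : 1 ≤ j ≤ t} satisfies |w|_S ≥ R. -/
/-- For `g` of infinite order, `Esub g` is the set of `h` such that `h⁻¹ gⁿ h = g^{±n}`
for some `n ≠ 0`. -/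
def Esub {G : Type*} [Group G] (g : G) : Set G :=
  {h : G | ∃ n : ℤ, n ≠ 0 ∧ (h⁻¹ * g ^ n * h = g ^ n ∨ h⁻¹ * g ^ n * h = g ^ (-n))}


namespace HypAux

structure HypLen {G : Type*} [Group G] (len : G → ℝ) (δ : ℝ) : Prop where
  hδ : 0 ≤ δ
  one : len 1 = 0
  inv : ∀ x, len x⁻¹ = len x
  mul : ∀ x y, len (x * y) ≤ len x + len y
  four : ∀ x y z w, len (x⁻¹ * y) + len (z⁻¹ * w) ≤
    max (len (x⁻¹ * z) + len (y⁻¹ * w)) (len (x⁻¹ * w) + len (y⁻¹ * z)) + 2 * δ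
  fin : ∀ r : ℝ, {x | len x ≤ r}.Finite
  mid : ∀ x, ∃ p, len p + len (p⁻¹ * x) = len x ∧ len x - 1 ≤ 2 * len p ∧ 2 * len p ≤ len x + 1

/-- Gromov product based at `1`. -/
noncomputable def gp {G : Type*} [Group G] (len : G → ℝ) (x y : G) : ℝ :=
  (len x + len y - len (x⁻¹ * y)) / 2

section
variable {G : Type*} [Group G] {len : G → ℝ} {δ : ℝ}

lemma HypLen.nonneg (H : HypLen len δ) (x : G) : 0 ≤ len x := by
  have h1 := H.mul x x⁻¹
  rw [mul_inv_cancel, H.one, H.inv] at h1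
  linarith

/-- distance symmetric -/
lemma HypLen.symm (H : HypLen len δ) (x y : G) : len (x⁻¹ * y) = len (y⁻¹ * x) := by
  rw [← H.inv]; simp

lemma HypLen.tri (H : HypLen len δ) (x y z : G) :
    len (x⁻¹ * z) ≤ len (x⁻¹ * y) + len (y⁻¹ * z) := by
  have := H.mul (x⁻¹ * y) (y⁻¹ * z)
  simpa [mul_assoc] using this

lemma HypLen.gp_symm (H : HypLen len δ) (x y : G) : gp len x y = gp len y x := by
  unfold gp; rw [H.symm x y]; ring

lemma HypLen.gp_one (H : HypLen len δ) (x : G) : gp len x 1 = 0 := by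
  unfold gp; simp [H.one, H.inv]

lemma HypLen.gp_le_right (H : HypLen len δ) (x y : G) : gp len x y ≤ len y := by
  unfold gp
  have h1 := H.mul y (y⁻¹ * x)
  rw [mul_inv_cancel_left, H.symm y x] at h1
  linarith

lemma HypLen.gp_le_left (H : HypLen len δ) (x y : G) : gp len x y ≤ len x := by
  rw [H.gp_symm]; exact H.gp_le_right y x

lemma HypLen.gp_hyp (H : HypLen len δ) (x y z : G) :
    min (gp len x y) (gp len y z) - δ ≤ gp len x z := by
  have h := H.four x z y 1
  simp only [mul_one, H.inv] at h
  rw [H.symm z y] at h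
  unfold gp
  rcases le_total (len (x⁻¹ * y) + len z) (len x + len (y⁻¹ * z)) with h1 | h1
  · rw [max_eq_right h1] at h
    have := min_le_right ((len x + len y - len (x⁻¹ * y)) / 2) ((len y + len z - len (y⁻¹ * z)) / 2)
    linarith
  · rw [max_eq_left h1] at h
    have := min_le_left ((len x + len y - len (x⁻¹ * y)) / 2) ((len y + len z - len (y⁻¹ * z)) / 2)
    linarith

/-- if `(x|y) ≤ C` and `(y|z) > C + δ` then `(x|z) ≤ C + δ`. -/
lemma HypLen.gp_step (H : HypLen len δ) {x y z : G} {C : ℝ} (h1 : gp len x y ≤ C)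
    (h2 : C + δ < gp len y z) : gp len x z ≤ C + δ := by
  have h := H.gp_hyp x z y
  rw [H.gp_symm z y] at h
  rcases min_choice (gp len x z) (gp len y z) with h3 | h3 <;> rw [h3] at h <;> linarith

lemma HypLen.gp_mul (H : HypLen len δ) (s w : G) :
    gp len s (s * w) = len s - gp len s⁻¹ w := by
  unfold gp; simp [H.inv]; ring

lemma HypLen.len_mul_eq (H : HypLen len δ) (s w : G) :
    len (s * w) = len s + len w - 2 * gp len s⁻¹ w := by
  unfold gp; simp [H.inv]; ring

lemma HypLen.list (H : HypLen len δ) {C l : ℝ} (hl : 2 * C + 2 * δ < l)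
    (A : Set G) (hA : ∀ s ∈ A, l ≤ len s) (hA2 : ∀ s ∈ A, ∀ s' ∈ A, gp len s⁻¹ s' ≤ C)
    (L : List G) (hL : ∀ s ∈ L, s ∈ A) (hne : L ≠ []) :
    ∃ s ∈ A, C + δ < gp len s L.prod := by
  induction L with
  | nil => exact absurd rfl hne
  | cons s L ih =>
    have hs : s ∈ A := hL s (by simp)
    have hls := hA s hs
    have hC := hA2 s hs s hs
    refine ⟨s, hs, ?_⟩
    rw [List.prod_cons, H.gp_mul]
    by_cases hL0 : L = []
    · subst hL0
      have : gp len s⁻¹ (1 : G) = 0 := H.gp_one _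
      simp only [List.prod_nil]
      rw [this]
      have h0 : -C ≤ 0 + l := by
        have : 0 ≤ gp len s⁻¹ s := by
          unfold gp
          have := H.mul s s
          simp only [inv_inv, H.inv]
          linarith
        have := H.hδ
        linarith
      have := H.hδ
      by_cases hC0 : 0 ≤ C
      · linarith
      · exfalso
        have : 0 ≤ gp len s⁻¹ s := by
          unfold gp
          have := H.mul s s
          simp only [inv_inv, H.inv]
          linarith
        linarith
    · obtain ⟨s', hs', h'⟩ := ih (fun x hx => hL x (by simp [hx])) hL0
      have := H.gp_step (hA2 s hs s' hs') h'
      linarith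

lemma HypLen.pow_le (H : HypLen len δ) (x : G) (n : ℕ) : len (x ^ n) ≤ n * len x := by
  induction n with
  | zero => simp [H.one]
  | succ n ih =>
    rw [pow_succ]
    have := H.mul (x ^ n) x
    push_cast
    linarith

lemma HypLen.pow_chain (H : HypLen len δ) {y : G} {C : ℝ} (hC : 0 ≤ C) (h1 : gp len y⁻¹ y ≤ C)
    (h2 : 2 * C + 3 * δ < len y) (n : ℕ) : gp len y⁻¹ (y ^ n) ≤ C + δ := by
  have hδ := H.hδ
  induction n with
  | zero => rw [pow_zero, H.gp_one]; linarith
  | succ n ih =>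
    refine H.gp_step h1 ?_
    rw [pow_succ', H.gp_mul]
    linarith

lemma HypLen.pow_quasi (H : HypLen len δ) {y : G} {C : ℝ} (hC : 0 ≤ C) (h1 : gp len y⁻¹ y ≤ C)
    (h2 : 2 * C + 3 * δ < len y) (m n : ℕ) :
    len (y ^ m) + len (y ^ n) ≤ len (y ^ (m + n)) + 2 * (C + 2 * δ) := by
  have hδ := H.hδ
  have key : gp len (y ^ m)⁻¹ (y ^ n) ≤ C + δ + δ := by
    cases n with
    | zero => rw [pow_zero, H.gp_one]; linarith
    | succ n =>
      have h3 : gp len (y ^ m)⁻¹ y ≤ C + δ := by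
        have := H.pow_chain (y := y⁻¹) hC (by rw [inv_inv, H.gp_symm]; exact h1)
          (by rwa [H.inv]) m
        rw [inv_inv, H.gp_symm] at this
        simpa using this
      refine H.gp_step h3 ?_
      rw [pow_succ', H.gp_mul]
      have := H.pow_chain hC h1 h2 n
      linarith
  rw [pow_add, H.len_mul_eq]
  linarith

lemma exists_pow_long (H : HypLen len δ) (f : ℕ → G) (hf : Function.Injective f) (T : ℝ) :
    ∃ n, T < len (f n) := by
  by_contra hcon
  push Not at hcon
  exact Set.infinite_range_of_injective hf ((H.fin T).subset (by rintro _ ⟨n, rfl⟩; exact hcon n))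

lemma exists_bound_long (H : HypLen len δ) (T : ℝ) : ∃ M : ℕ, ∀ f : ℕ → G, Function.Injective f →
    ∃ n ≤ M, T < len (f n) := by
  classical
  refine ⟨(H.fin T).toFinset.card, fun f hf => ?_⟩
  by_contra hcon
  push Not at hcon
  have := Finset.card_le_card_of_injOn (s := Finset.range ((H.fin T).toFinset.card + 1))
    (t := (H.fin T).toFinset) f (by
      intro i hi
      simp only [Finset.coe_range, Set.mem_Iio] at hi
      simpa using hcon i (by omega)) hf.injOn
  simp at this

lemma pow_inj {g : G} (hg : ¬ IsOfFinOrder g) : Function.Injective (fun n : ℕ => g ^ n) :=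
  injective_pow_iff_not_isOfFinOrder.mpr hg

lemma HypLen.exists_axis (H : HypLen len δ) {g : G} (hg : ¬ IsOfFinOrder g) :
    ∃ k : ℕ, 0 < k ∧ ∃ p : G, gp len (p⁻¹ * g ^ k * p)⁻¹ (p⁻¹ * g ^ k * p) ≤ 7 * δ ∧
      20 * δ + 1 < len (p⁻¹ * g ^ k * p) := by
  have hδ := H.hδ
  obtain ⟨M, hM⟩ := exists_bound_long H (20 * δ + 1)
  set D : ℝ := M * len g with hD
  have hD0 : 0 ≤ D := mul_nonneg (by positivity) (H.nonneg g)
  obtain ⟨N, hN⟩ := exists_pow_long H _ (pow_inj hg) (10 * D + 20 * δ + 10)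
  obtain ⟨p, hp1, hp2, hp3⟩ := H.mid (g ^ N)
  obtain ⟨k, hkM, hk⟩ := hM (fun n => p⁻¹ * g ^ n * p) (fun a b hab => by
    simp only [mul_left_inj, mul_right_inj] at hab
    exact pow_inj hg hab)
  have hk0 : 0 < k := by
    rcases Nat.eq_zero_or_pos k with h | h
    · subst h
      simp [H.one] at hk
      linarith
    · exact h
  refine ⟨k, hk0, p, ?_, hk⟩
  set b := g ^ N with hb
  set h := g ^ k with hh
  have hcomm : h * b = b * h := by rw [hb, hh, ← pow_add, ← pow_add, add_comm]
  have hhD : len h ≤ D := by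
    refine (H.pow_le g k).trans ?_
    exact mul_le_mul_of_nonneg_right (by exact_mod_cast hkM) (H.nonneg g)
  set L := len b with hL
  -- t0 = len p, t1 = len (h p), t2 = len (h h p)
  have ea : len (h⁻¹⁻¹ * p) = len (h * p) := by simp
  have eb : len ((h⁻¹ * b)⁻¹ * p) = len (b⁻¹ * (h * p)) := by
    congr 1; simp [mul_assoc]
  have ebb : len (b⁻¹ * (h⁻¹ * b)) ≤ D := by
    have : b⁻¹ * (h⁻¹ * b) = h⁻¹ := by
      rw [inv_mul_eq_iff_eq_mul, inv_mul_eq_iff_eq_mul, ← mul_assoc, hcomm]; simp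
    rw [this, H.inv]; exact hhD
  have eab : len (h⁻¹⁻¹ * (h⁻¹ * b)) = L := by simp [hL]
  have eS : len (p⁻¹ * b) = len (b⁻¹ * p) := H.symm _ _
  have hpb : len (b⁻¹ * p) = L - len p := by rw [← eS]; linarith
  -- triangle bounds
  have t1a : len (h * p) ≤ D + len p := (H.mul h p).trans (by linarith)
  have t1b : len p ≤ D + len (h * p) := by
    have := H.mul h⁻¹ (h * p)
    rw [inv_mul_cancel_left, H.inv] at this
    linarith
  have u1 : len (p⁻¹ * b) ≤ len (p⁻¹ * (h⁻¹ * b)) + D := by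
    have := H.tri p (h⁻¹ * b) b
    rw [H.symm (h⁻¹ * b) b] at this
    linarith
  have ehb : L ≤ len (h * b) + D := by
    have := H.mul h⁻¹ (h * b)
    rw [inv_mul_cancel_left, H.inv] at this
    linarith
  have f1 := H.four h⁻¹ p 1 b
  simp only [inv_inv, mul_one, inv_one, one_mul, H.inv] at f1
  have f2 := H.four p (h⁻¹ * b) h⁻¹ b
  rw [H.symm p h⁻¹, H.symm (h⁻¹ * b) b, H.symm (h⁻¹ * b) h⁻¹, eab] at f2
  simp only [inv_inv] at f2
  have eb2 : len (p⁻¹ * (h⁻¹ * b)) = len (b⁻¹ * (h * p)) := by rw [H.symm, eb]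
  have hexc : len (h * p) + len (b⁻¹ * (h * p)) ≤ L + 4 * δ := by
    rcases max_choice (len h + len (p⁻¹ * b)) (len (h * b) + len p) with h3 | h3 <;>
    rcases max_choice (len (h * p) + len (b⁻¹ * (h⁻¹ * b))) (len (p⁻¹ * b) + L) with h4 | h4 <;>
    rw [h3] at f1 <;> rw [h4] at f2 <;> linarith
  have hdist : len (p⁻¹ * h * p) ≤ |len (h * p) - len p| + 6 * δ := by
    have f3 := H.four (h * p) p 1 b
    have e3 : len ((h * p)⁻¹ * p) = len (p⁻¹ * h * p) := by rw [H.symm, mul_assoc]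
    have e4 : len ((h * p)⁻¹ * b) = len (b⁻¹ * (h * p)) := H.symm _ _
    simp only [mul_one, inv_one, one_mul, e3, e4] at f3
    rw [H.inv, H.inv] at f3
    have q1 := le_abs_self (len (h * p) - len p)
    have q2 := neg_abs_le (len (h * p) - len p)
    rcases max_choice (len (h * p) + len (p⁻¹ * b)) (len (b⁻¹ * (h * p)) + len p) with h3 | h3 <;>
    rw [h3] at f3 <;> linarith
  have habs : |len (h * p) - len p| ≤ D := by rw [abs_le]; constructor <;> linarith
  have t2a : len (h * p) ≤ D + len (h * (h * p)) := by
    have := H.mul h⁻¹ (h * (h * p))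
    rw [inv_mul_cancel_left, H.inv] at this
    linarith
  have hadd : |(len (h * (h * p)) - len (h * p)) - (len (h * p) - len p)| ≤ 2 * δ := by
    have e3 : len (p⁻¹ * (h * p)) = len (p⁻¹ * h * p) := by rw [mul_assoc]
    have e4 : len ((h * p)⁻¹ * p) = len (p⁻¹ * h * p) := by rw [H.symm, mul_assoc]
    have e5 : len (p⁻¹ * h⁻¹) = len (h * p) := by rw [← H.inv]; simp
    have e6 : len ((h * p)⁻¹ * h⁻¹) = len (h * (h * p)) := by rw [← H.inv]; simp
    have f4 := H.four 1 p h⁻¹ (h * p)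
    have f5 := H.four 1 (h * p) h⁻¹ p
    simp only [inv_one, one_mul, inv_inv, e3, e4, e5, e6, H.inv] at f4 f5
    rw [abs_le]
    rcases max_choice (len h + len (p⁻¹ * h * p)) (len (h * p) + len (h * p)) with h3 | h3 <;>
    rcases max_choice (len h + len (p⁻¹ * h * p)) (len p + len (h * (h * p))) with h4 | h4 <;>
    rw [h3] at f4 <;> rw [h4] at f5 <;> constructor <;> linarith
  have hsq : |len (h * (h * p)) - len p| ≤ len (p⁻¹ * h * p * (p⁻¹ * h * p)) := by
    have e : p⁻¹ * h * p * (p⁻¹ * h * p) = p⁻¹ * (h * (h * p)) := by simp [mul_assoc]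
    rw [e]
    have q1 := H.mul p (p⁻¹ * (h * (h * p)))
    have q2 := H.tri (h * (h * p)) p 1
    rw [H.symm (h * (h * p)) p, mul_one, mul_one, H.inv, H.inv] at q2
    have q3 := H.tri p (h * (h * p)) 1
    rw [mul_one, mul_one, H.inv, H.inv] at q3
    rw [abs_le]; constructor <;> linarith
  unfold gp
  rw [H.inv, inv_inv]
  have q1 := abs_le.mp hadd
  have q2 := abs_le.mp hsq
  rcases abs_cases (len (h * p) - len p) with ⟨q, _⟩ | ⟨q, _⟩ <;> rw [q] at hdist <;> linarith

lemma HypLen.abs_mul (H : HypLen len δ) (x y : G) :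
    len (x * y) ≤ len x + len y ∧ len x ≤ len (x * y) + len y ∧ len y ≤ len (x * y) + len x := by
  refine ⟨H.mul x y, ?_, ?_⟩
  · have := H.mul (x * y) y⁻¹
    rwa [mul_inv_cancel_right, H.inv] at this
  · have := H.mul x⁻¹ (x * y)
    rw [inv_mul_cancel_left, H.inv] at this
    linarith

lemma HypLen.quasi (H : HypLen len δ) {g : G} (hg : ¬ IsOfFinOrder g) :
    ∃ C : ℝ, 0 ≤ C ∧ ∀ m n : ℕ, len (g ^ m) + len (g ^ n) ≤ len (g ^ (m + n)) + C := by
  have hδ := H.hδ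
  obtain ⟨k, hk, p, h1, h2⟩ := H.exists_axis hg
  have hq := H.pow_quasi (y := p⁻¹ * g ^ k * p) (C := 7 * δ) (by linarith) h1 (by linarith)
  have hy : ∀ q : ℕ, (p⁻¹ * g ^ k * p) ^ q = p⁻¹ * g ^ (k * q) * p := by
    intro q
    have := conj_pow (i := q) (a := p⁻¹) (b := g ^ k)
    rw [inv_inv] at this
    rw [this, pow_mul]
  have hc : ∀ q : ℕ, len (g ^ (k * q)) ≤ len ((p⁻¹ * g ^ k * p) ^ q) + 2 * len p ∧
      len ((p⁻¹ * g ^ k * p) ^ q) ≤ len (g ^ (k * q)) + 2 * len p := by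
    intro q
    rw [hy]
    have a1 := H.abs_mul (p⁻¹ * g ^ (k * q)) p
    have a2 := H.abs_mul p⁻¹ (g ^ (k * q))
    rw [H.inv] at a2
    constructor <;> linarith [a1.1, a1.2.1, a1.2.2, a2.1, a2.2.1, a2.2.2]
  set E := (k : ℝ) * len g with hE
  have hg0 := H.nonneg g
  have hp0 := H.nonneg p
  have hE0 : 0 ≤ E := by positivity
  have hr : ∀ r < k, len (g ^ r) ≤ E := fun r hr => (H.pow_le g r).trans
    (mul_le_mul_of_nonneg_right (by exact_mod_cast hr.le) hg0)
  refine ⟨2 * (7 * δ + 2 * δ) + 6 * len p + 4 * E, by linarith, fun m n => ?_⟩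
  have em : g ^ m = g ^ (k * (m / k)) * g ^ (m % k) := by rw [← pow_add, Nat.div_add_mod]
  have en : g ^ n = g ^ (k * (n / k)) * g ^ (n % k) := by rw [← pow_add, Nat.div_add_mod]
  have emn : g ^ (m + n) = g ^ (k * (m / k + n / k)) * (g ^ (m % k) * g ^ (n % k)) := by
    rw [← pow_add, ← pow_add]
    congr 1
    have := Nat.div_add_mod m k
    have := Nat.div_add_mod n k
    rw [mul_add]; omega
  have b1 := (H.abs_mul (g ^ (k * (m / k))) (g ^ (m % k))).1
  have b2 := (H.abs_mul (g ^ (k * (n / k))) (g ^ (n % k))).1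
  have b3 := (H.abs_mul (g ^ (k * (m / k + n / k))) (g ^ (m % k) * g ^ (n % k))).2.1
  have b4 := (H.abs_mul (g ^ (m % k)) (g ^ (n % k))).1
  rw [← em] at b1
  rw [← en] at b2
  rw [← emn] at b3
  have r1 := hr _ (Nat.mod_lt m hk)
  have r2 := hr _ (Nat.mod_lt n hk)
  have := hq (m / k) (n / k)
  have := (hc (m / k)).1
  have := (hc (n / k)).1
  have := (hc (m / k + n / k)).2
  linarith

lemma HypLen.zpow_abs (H : HypLen len δ) (g : G) (z : ℤ) : len (g ^ z) = len (g ^ z.natAbs) := by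
  rcases Int.natAbs_eq z with h | h
  · conv_lhs => rw [h]
    rw [zpow_natCast]
  · conv_lhs => rw [h]
    rw [zpow_neg, zpow_natCast, H.inv]

lemma HypLen.conj_le (H : HypLen len δ) {g : G} (hg : ¬ IsOfFinOrder g) {c : G} {m l : ℤ}
    (h : c⁻¹ * g ^ m * c = g ^ l) : m.natAbs ≤ l.natAbs := by
  obtain ⟨C, hC, hq⟩ := H.quasi hg
  by_contra hlt
  push Not at hlt
  obtain ⟨n, hn⟩ := exists_pow_long H _ (pow_inj hg) (m.natAbs * C + 2 * len c)
  have low : ∀ k : ℕ, k * (len (g ^ n) - C) ≤ len (g ^ (n * k)) := by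
    intro k
    induction k with
    | zero => simp [H.one]
    | succ k ih =>
      have := hq (n * k) n
      rw [mul_add, mul_one]
      push_cast
      linarith
  have h2 : c⁻¹ * g ^ (m * n) * c = g ^ (l * n) := by
    have := conj_zpow (i := (n : ℤ)) (a := c⁻¹) (b := g ^ m)
    rw [inv_inv, h] at this
    rw [zpow_mul, zpow_mul, this]
  have a1 := H.abs_mul (c⁻¹ * g ^ (m * n)) c
  have a2 := H.abs_mul c⁻¹ (g ^ (m * n))
  rw [H.inv] at a2
  rw [h2] at a1
  rw [H.zpow_abs g (m * n), Int.natAbs_mul, Int.natAbs_natCast, mul_comm m.natAbs n] at a2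
  rw [H.zpow_abs g (l * n), Int.natAbs_mul, Int.natAbs_natCast, mul_comm l.natAbs n, pow_mul] at a1
  have u := H.pow_le (g ^ n) l.natAbs
  have lo := low m.natAbs
  have hlt' : (l.natAbs : ℝ) + 1 ≤ m.natAbs := by exact_mod_cast hlt
  have hn0 := H.nonneg (g ^ n)
  have := mul_le_mul_of_nonneg_right hlt' hn0
  linarith [a1.2.1, a2.2.2]

lemma HypLen.conj_eq (H : HypLen len δ) {g : G} (hg : ¬ IsOfFinOrder g) {c : G} {m l : ℤ}
    (h : c⁻¹ * g ^ m * c = g ^ l) : l = m ∨ l = -m := by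
  have h1 := H.conj_le hg h
  have h2 := H.conj_le (c := c⁻¹) (m := l) (l := m) hg (by rw [← h]; simp [mul_assoc])
  exact Int.natAbs_eq_natAbs_iff.mp (le_antisymm h2 h1)

lemma HypLen.fellow (H : HypLen len δ) {h k c : G} (hh : ¬ IsOfFinOrder h)
    (hk : ¬ IsOfFinOrder k)
    (hunb : ∀ Q : ℝ, ∃ a b : ℕ, Q < gp len (h ^ a) (c * k ^ b)) :
    ∃ m l : ℤ, m ≠ 0 ∧ c⁻¹ * h ^ m * c = k ^ l := by
  classical
  have hδ := H.hδ
  obtain ⟨C₁, hC₁, hq₁⟩ := H.quasi hh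
  obtain ⟨C₂, hC₂, hq₂⟩ := H.quasi hk
  have hc0 := H.nonneg c
  have hk0 := H.nonneg k
  have hh0 := H.nonneg h
  set K : ℝ := 3 * len c + len k + C₁ + C₂ + 4 * δ with hK
  set I := (H.fin K).toFinset.card with hI
  obtain ⟨a, b, hab⟩ := hunb (I * len h)
  have hIa : I < a := by
    by_contra hcon
    push Not at hcon
    have h1 := H.gp_le_left (h ^ a) (c * k ^ b)
    have h2 := H.pow_le h a
    have h3 : (a : ℝ) * len h ≤ I * len h :=
      mul_le_mul_of_nonneg_right (by exact_mod_cast hcon) hh0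
    linarith
  have key : ∀ i : ℕ, ∃ j : ℕ, i ≤ I → len ((h ^ i)⁻¹ * (c * k ^ j)) ≤ K := by
    intro i
    by_cases hi : i ≤ I
    swap
    · exact ⟨0, fun h => absurd h hi⟩
    have hX : len (h ^ i) ≤ I * len h := (H.pow_le h i).trans
      (mul_le_mul_of_nonneg_right (by exact_mod_cast hi) hh0)
    have hex : ∃ j, len (h ^ i) ≤ len (c * k ^ j) :=
      ⟨b, by linarith [H.gp_le_right (h ^ a) (c * k ^ b)]⟩
    refine ⟨Nat.find hex, fun _ => ?_⟩
    have hj1 := Nat.find_spec hex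
    have hjb : Nat.find hex ≤ b := Nat.find_min' hex
      (by linarith [H.gp_le_right (h ^ a) (c * k ^ b)])
    have hj2 : len (c * k ^ (Nat.find hex)) ≤ len (h ^ i) + len k + len c := by
      rcases Nat.eq_zero_or_pos (Nat.find hex) with h0 | h0
      · rw [h0]
        simp only [pow_zero, mul_one]
        linarith [H.nonneg (h ^ i)]
      · have h1 := Nat.find_min hex (m := Nat.find hex - 1) (by omega)
        push Not at h1
        have h2 : c * k ^ (Nat.find hex) = c * k ^ (Nat.find hex - 1) * k := by
          rw [mul_assoc, ← pow_succ]; congr 2; omega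
        rw [h2]
        linarith [H.mul (c * k ^ (Nat.find hex - 1)) k]
    generalize Nat.find hex = j at hj1 hj2 hjb
    have g1 : len (h ^ i) - C₁ / 2 ≤ gp len (h ^ i) (h ^ a) := by
      unfold gp
      have e : (h ^ i)⁻¹ * h ^ a = h ^ (a - i) := by
        rw [inv_mul_eq_iff_eq_mul, ← pow_add]; congr 1; omega
      rw [e]
      have := hq₁ i (a - i)
      rw [show i + (a - i) = a by omega] at this
      linarith
    have g3 : len (c * k ^ j) - C₂ / 2 - len c ≤ gp len (c * k ^ b) (c * k ^ j) := by
      rw [H.gp_symm]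
      unfold gp
      have e : (c * k ^ j)⁻¹ * (c * k ^ b) = k ^ (b - j) := by
        rw [inv_mul_eq_iff_eq_mul, mul_assoc, ← pow_add]; congr 2; omega
      rw [e]
      have := hq₂ j (b - j)
      rw [show j + (b - j) = b by omega] at this
      have := (H.abs_mul c (k ^ b)).2.2
      have := (H.abs_mul c (k ^ j)).1
      linarith
    have g4 : len (h ^ i) - C₁ / 2 - δ ≤ gp len (h ^ i) (c * k ^ b) := by
      refine le_trans (sub_le_sub_right ?_ _) (H.gp_hyp _ (h ^ a) _)
      exact le_min g1 (by linarith)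
    have g5 : len (h ^ i) - C₁ / 2 - C₂ / 2 - len c - δ - δ ≤ gp len (h ^ i) (c * k ^ j) := by
      refine le_trans (sub_le_sub_right ?_ _) (H.gp_hyp _ (c * k ^ b) _)
      exact le_min (by linarith) (by linarith)
    unfold gp at g5
    linarith
  choose j hj using key
  obtain ⟨x, hx, y, hy, hxy, he⟩ := Finset.exists_ne_map_eq_of_card_lt_of_maps_to
    (s := Finset.range (I + 1)) (t := (H.fin K).toFinset)
    (f := fun i => (h ^ i)⁻¹ * (c * k ^ (j i))) (by simp [hI]) (by
      intro i hi
      simp only [Finset.coe_range, Set.mem_Iio] at hi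
      simpa using hj i (by omega))
  refine ⟨(y : ℤ) - x, (j y : ℤ) - j x, by omega, ?_⟩
  rw [zpow_sub, zpow_sub, zpow_natCast, zpow_natCast, zpow_natCast, zpow_natCast]
  have e1 : c * k ^ j y = h ^ y * ((h ^ x)⁻¹ * (c * k ^ j x)) := by rw [he]; simp
  have e2 : k ^ j y = c⁻¹ * (h ^ y * ((h ^ x)⁻¹ * (c * k ^ j x))) := by rw [← e1]; simp
  rw [e2]; simp [mul_assoc]

lemma HypLen.gp_bdd_aux (H : HypLen len δ) {g c : G} (hg : ¬ IsOfFinOrder g)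
    (hc : ∀ m : ℤ, m ≠ 0 → c⁻¹ * g ^ m * c ≠ g ^ m ∧ c⁻¹ * g ^ m * c ≠ g ^ (-m))
    (h k : G) (hh : h = g ∨ h = g⁻¹) (hk : k = g ∨ k = g⁻¹) :
    ∃ B : ℝ, ∀ a b : ℕ, gp len (h ^ a) (c * k ^ b) ≤ B := by
  by_contra hcon
  push Not at hcon
  have hh' : ¬ IsOfFinOrder h := by rcases hh with rfl | rfl <;> simpa using hg
  have hk' : ¬ IsOfFinOrder k := by rcases hk with rfl | rfl <;> simpa using hg
  obtain ⟨m, l, hm, he⟩ := H.fellow hh' hk' hcon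
  have : ∃ m l : ℤ, m ≠ 0 ∧ c⁻¹ * g ^ m * c = g ^ l := by
    rcases hh with rfl | rfl <;> rcases hk with rfl | rfl
    · exact ⟨m, l, hm, he⟩
    · exact ⟨m, -l, hm, by simpa using he⟩
    · exact ⟨-m, l, by omega, by simpa using he⟩
    · exact ⟨-m, -l, by omega, by simpa using he⟩
  obtain ⟨m, l, hm, he⟩ := this
  rcases H.conj_eq hg he with rfl | rfl
  · exact (hc _ hm).1 he
  · exact (hc _ hm).2 he

lemma HypLen.gp_bdd (H : HypLen len δ) {g c : G} (hg : ¬ IsOfFinOrder g)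
    (hc : ∀ m : ℤ, m ≠ 0 → c⁻¹ * g ^ m * c ≠ g ^ m ∧ c⁻¹ * g ^ m * c ≠ g ^ (-m)) :
    ∃ B : ℝ, ∀ a b : ℤ, gp len (g ^ a) (c * g ^ b) ≤ B := by
  obtain ⟨B1, h1⟩ := H.gp_bdd_aux hg hc g g (Or.inl rfl) (Or.inl rfl)
  obtain ⟨B2, h2⟩ := H.gp_bdd_aux hg hc g g⁻¹ (Or.inl rfl) (Or.inr rfl)
  obtain ⟨B3, h3⟩ := H.gp_bdd_aux hg hc g⁻¹ g (Or.inr rfl) (Or.inl rfl)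
  obtain ⟨B4, h4⟩ := H.gp_bdd_aux hg hc g⁻¹ g⁻¹ (Or.inr rfl) (Or.inr rfl)
  refine ⟨max (max B1 B2) (max B3 B4), fun a b => ?_⟩
  obtain ⟨x, rfl | rfl⟩ := Int.eq_nat_or_neg a <;> obtain ⟨y, rfl | rfl⟩ := Int.eq_nat_or_neg b
  · rw [zpow_natCast, zpow_natCast]
    exact (h1 x y).trans (by simp)
  · rw [zpow_natCast, zpow_neg, zpow_natCast, ← inv_pow]
    exact (h2 x y).trans (by simp)
  · rw [zpow_natCast, zpow_neg, zpow_natCast, ← inv_pow]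
    exact (h3 x y).trans (by simp)
  · rw [zpow_neg, zpow_neg, zpow_natCast, zpow_natCast, ← inv_pow, ← inv_pow]
    exact (h4 x y).trans (by simp)

lemma HypLen.long (H : HypLen len δ) {g : G} (hg : ¬ IsOfFinOrder g) (T : ℝ) :
    ∃ N : ℕ, 0 < N ∧ ∀ z : ℤ, N ≤ z.natAbs → T ≤ len (g ^ z) := by
  have hfin : {n : ℕ | len (g ^ n) ≤ T}.Finite :=
    (H.fin T).preimage (f := fun n : ℕ => g ^ n) (pow_inj hg).injOn
  obtain ⟨N, hN⟩ := hfin.bddAbove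
  refine ⟨N + 1, by omega, fun z hz => ?_⟩
  rw [H.zpow_abs]
  by_contra hcon
  push Not at hcon
  have := hN (show z.natAbs ∈ {n : ℕ | len (g ^ n) ≤ T} from hcon.le)
  omega

lemma HypLen.gp_mul_left_le (H : HypLen len δ) (x y z : G) :
    gp len (x * y) z ≤ gp len x z + len y := by
  unfold gp
  have h1 := H.mul x y
  have h2 := H.mul y ((x * y)⁻¹ * z)
  have e : y * ((x * y)⁻¹ * z) = x⁻¹ * z := by simp [mul_assoc]
  rw [e] at h2
  linarith

/-- Regrouping a product of elements `g ^ pre x * mid x * g ^ post x`. -/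
def segs {ι : Type*} (g : G) (pre post : ι → ℤ) (mid : ι → G) : List ι → List G
  | [] => []
  | [x] => [mid x * g ^ post x]
  | x :: y :: L => (mid x * g ^ (post x + pre y)) :: segs g pre post mid (y :: L)

lemma segs_ne_nil {ι : Type*} (g : G) (pre post : ι → ℤ) (mid : ι → G) (x : ι) (L : List ι) :
    segs g pre post mid (x :: L) ≠ [] := by
  cases L <;> simp [segs]

lemma segs_prod {ι : Type*} (g : G) (pre post : ι → ℤ) (mid : ι → G) (L : List ι) : ∀ x : ι,
    ((x :: L).map (fun x => g ^ pre x * mid x * g ^ post x)).prod =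
      g ^ pre x * (segs g pre post mid (x :: L)).prod := by
  induction L with
  | nil => intro x; simp [segs, mul_assoc]
  | cons y L ih =>
    intro x
    rw [List.map_cons, List.prod_cons, ih y, segs, List.prod_cons, zpow_add]
    simp only [mul_assoc]

lemma segs_mem {ι : Type*} (g : G) (pre post : ι → ℤ) (mid : ι → G) (r : ι → ι → Prop) (N : ℕ)
    (h1 : ∀ x, N ≤ (post x).natAbs) (h2 : ∀ x y, r x y → N ≤ (post x + pre y).natAbs)
    (L : List ι) : L.IsChain r → ∀ s ∈ segs g pre post mid L,
      ∃ x : ι, ∃ a : ℤ, N ≤ a.natAbs ∧ s = mid x * g ^ a := by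
  induction L with
  | nil => intro _ s hs; simp [segs] at hs
  | cons x L ih =>
    intro hL s hs
    cases L with
    | nil =>
      simp only [segs, List.mem_singleton] at hs
      exact ⟨x, _, h1 x, hs⟩
    | cons y L =>
      rw [List.isChain_cons_cons] at hL
      simp only [segs, List.mem_cons] at hs
      rcases hs with hs | hs
      · exact ⟨x, _, h2 x y hL.1, hs⟩
      · exact ih hL.2 s hs

lemma HypLen.main (H : HypLen len δ) {g : G} (hg : ¬ IsOfFinOrder g) {t : ℕ} (c : Fin t → G)
    (hc : ∀ j, c j ∉ Esub g) (R : ℝ) :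
    ∃ n : Fin t → ℕ, (∀ j, 0 < n j) ∧
      ∀ w ∈ Subgroup.closure {x : G | ∃ j : Fin t, x = g ^ (n j) * c j * g ^ (10 * n j)},
        w ≠ 1 → R ≤ len w := by
  classical
  have hδ := H.hδ
  let mid : Fin t × Bool → G := fun x => cond x.2 (c x.1) (c x.1)⁻¹
  have hmid : ∀ x : Fin t × Bool, ∃ B : ℝ, ∀ a b : ℤ, gp len (g ^ a) (mid x * g ^ b) ≤ B := by
    rintro ⟨j, e⟩
    refine H.gp_bdd hg fun m hm => ?_
    cases e
    · constructor
      · intro h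
        refine hc j ⟨m, hm, Or.inl ?_⟩
        simp only [mid, cond_false, inv_inv] at h
        rw [mul_inv_eq_iff_eq_mul] at h
        rw [mul_assoc, inv_mul_eq_iff_eq_mul, h]
      · intro h
        refine hc j ⟨m, hm, Or.inr ?_⟩
        simp only [mid, cond_false, inv_inv] at h
        have h' : c j * g ^ (-m) * (c j)⁻¹ = g ^ m := by
          have := congrArg (fun z => z⁻¹) h
          simpa [mul_assoc] using this
        rw [mul_inv_eq_iff_eq_mul] at h'
        rw [mul_assoc, inv_mul_eq_iff_eq_mul, h']
    · exact ⟨fun h => hc j ⟨m, hm, Or.inl h⟩, fun h => hc j ⟨m, hm, Or.inr h⟩⟩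
  choose B hB using hmid
  obtain ⟨Bm, hBm⟩ := (Set.finite_range B).bddAbove
  obtain ⟨Lm, hLm⟩ := (Set.finite_range (fun x => len (mid x))).bddAbove
  have hBm' : ∀ x, B x ≤ Bm := fun x => hBm ⟨x, rfl⟩
  have hLm' : ∀ x, len (mid x) ≤ Lm := fun x => hLm ⟨x, rfl⟩
  set C : ℝ := |Bm| + |Lm| with hC
  have hB0 := le_abs_self Bm
  have hL0 := le_abs_self Lm
  have hB1 := abs_nonneg Bm
  have hL1 := abs_nonneg Lm
  obtain ⟨N, hN0, hN⟩ := H.long hg (2 * C + 2 * δ + 1 + |Lm| + |R|)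
  have hR0 := le_abs_self R
  have hR1 := abs_nonneg R
  let n : Fin t → ℕ := fun j => N * (j + 1)
  have hnN : ∀ j, (N : ℤ) ≤ n j := fun j => by
    have : N ≤ n j := Nat.le_mul_of_pos_right N (by omega)
    exact_mod_cast this
  have hnd : ∀ i j, i ≠ j → (N : ℤ) ≤ |(n i : ℤ) - n j| := fun i j hij => by
    have e : (n i : ℤ) - n j = N * ((i : ℤ) - j) := by simp only [n]; push_cast; ring
    rw [e, _root_.abs_mul, Nat.abs_cast]
    have h1 : 1 ≤ |((i : ℕ) : ℤ) - (j : ℕ)| := by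
      apply Int.one_le_abs
      intro h
      exact hij (Fin.ext (by omega))
    nlinarith
  let pre : Fin t × Bool → ℤ := fun x => cond x.2 (n x.1 : ℤ) (-(10 * n x.1))
  let post : Fin t × Bool → ℤ := fun x => cond x.2 (10 * n x.1 : ℤ) (-(n x.1))
  have hpre : ∀ x, N ≤ (pre x).natAbs := by
    rintro ⟨j, e⟩
    have := hnN j
    cases e <;> simp only [pre, cond_true, cond_false] <;> omega
  have hpost : ∀ x, N ≤ (post x).natAbs := by
    rintro ⟨j, e⟩
    have := hnN j
    cases e <;> simp only [post, cond_true, cond_false] <;> omega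
  have hpp : ∀ x y : Fin t × Bool, (x.1 = y.1 → x.2 = y.2) → N ≤ (post x + pre y).natAbs := by
    rintro ⟨i, e⟩ ⟨j, e'⟩ h
    have hi := hnN i
    have hj := hnN j
    have hd := hnd i j
    rcases e <;> rcases e' <;> simp only [post, pre, cond_true, cond_false] <;>
      simp only [reduceCtorEq, imp_false] at h
    · omega
    · have := hd h
      rcases abs_cases ((n i : ℤ) - n j) with ⟨q, _⟩ | ⟨q, _⟩ <;> omega
    · have := hd h
      rcases abs_cases ((n i : ℤ) - n j) with ⟨q, _⟩ | ⟨q, _⟩ <;> omega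
    · omega
  refine ⟨n, fun j => by have := hnN j; omega, fun w hw hw1 => ?_⟩
  set f : Fin t → G := fun j => g ^ (n j) * c j * g ^ (10 * n j) with hf
  have hw' : w ∈ (FreeGroup.lift f).range := by
    refine (Subgroup.closure_le _).mpr ?_ hw
    rintro _ ⟨j, rfl⟩
    exact ⟨FreeGroup.of j, by simp [hf]⟩
  obtain ⟨z, rfl⟩ := hw'
  have hred : FreeGroup.IsReduced z.toWord := FreeGroup.isReduced_toWord
  have hz : FreeGroup.lift f z =
      (z.toWord.map (fun x => g ^ pre x * mid x * g ^ post x)).prod := by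
    conv_lhs => rw [← FreeGroup.mk_toWord (x := z)]
    rw [FreeGroup.lift_mk]
    congr 2
    funext x
    rcases x with ⟨j, e⟩
    cases e
    · simp only [cond_false, hf, pre, mid, post, zpow_neg]
      rw [mul_inv_rev, mul_inv_rev, ← mul_assoc]
      norm_cast
    · simp only [cond_true, hf, pre, mid, post]
      norm_cast
  rw [hz] at hw1 ⊢
  unfold FreeGroup.IsReduced at hred
  generalize z.toWord = W at hred hw1
  cases W with
  | nil => simp at hw1
  | cons x W =>
    rw [segs_prod]
    have hmem := segs_mem g pre post mid _ N hpost hpp (x :: W) hred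
    obtain ⟨s, ⟨y, a, ha, rfl⟩, hs⟩ := H.list (C := C) (l := 2 * C + 2 * δ + 1) (by linarith)
      {s | ∃ x : Fin t × Bool, ∃ a : ℤ, N ≤ a.natAbs ∧ s = mid x * g ^ a}
      (by
        rintro _ ⟨x, a, ha, rfl⟩
        have h1 := hN a ha
        have h2 := (H.abs_mul (mid x) (g ^ a)).2.2
        have h3 := hLm' x
        linarith)
      (by
        rintro _ ⟨x, a, ha, rfl⟩ _ ⟨y, b, hb, rfl⟩
        have h1 := hB y (-a) b
        have h2 := hBm' y
        have h3 := hLm' x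
        have h4 := H.gp_mul_left_le (g ^ (-a)) (mid x)⁻¹ (mid y * g ^ b)
        rw [H.inv] at h4
        rw [mul_inv_rev, ← zpow_neg]
        linarith)
      _ hmem (segs_ne_nil _ _ _ _ _ _)
    have hstep := H.gp_step (x := (g ^ pre x)⁻¹) (C := C) (by
      have h1 := hB y (-(pre x)) a
      have h2 := hBm' y
      rw [zpow_neg] at h1
      linarith) hs
    have h1 := hN (pre x) (hpre x)
    rw [H.len_mul_eq]
    have := H.nonneg (segs g pre post mid (x :: W)).prod
    linarith

end

section
variable {G : Type*} [Group G]

lemma wl_spec {S : Set G} (hS : Subgroup.closure S = ⊤) (x : G) :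
    ∃ l : List G, l.length = wordLength S x ∧ (∀ y ∈ l, y ∈ S ∨ y⁻¹ ∈ S) ∧ l.prod = x := by
  have hne : {n : ℕ | ∃ l : List G, l.length = n ∧ (∀ x ∈ l, x ∈ S ∨ x⁻¹ ∈ S) ∧
      l.prod = x}.Nonempty := by
    have hx : x ∈ Subgroup.closure S := by rw [hS]; trivial
    rw [← Subgroup.mem_toSubmonoid, Subgroup.closure_toSubmonoid] at hx
    obtain ⟨l, hl, hp⟩ := Submonoid.exists_list_of_mem_closure hx
    exact ⟨l.length, l, rfl, fun y hy => by simpa using hl y hy, hp⟩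
  exact Nat.sInf_mem hne

lemma wl_le {S : Set G} (l : List G) (hl : ∀ y ∈ l, y ∈ S ∨ y⁻¹ ∈ S) :
    wordLength S l.prod ≤ l.length :=
  Nat.sInf_le ⟨l, rfl, hl, rfl⟩

lemma wl_mul {S : Set G} (hS : Subgroup.closure S = ⊤) (x y : G) :
    wordLength S (x * y) ≤ wordLength S x + wordLength S y := by
  obtain ⟨l, h1, h2, rfl⟩ := wl_spec hS x
  obtain ⟨l', h1', h2', rfl⟩ := wl_spec hS y
  rw [← h1, ← h1', ← List.prod_append, ← List.length_append]
  refine wl_le _ fun z hz => ?_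
  rcases List.mem_append.mp hz with h | h
  exacts [h2 z h, h2' z h]

lemma wl_inv_le {S : Set G} (hS : Subgroup.closure S = ⊤) (x : G) :
    wordLength S x⁻¹ ≤ wordLength S x := by
  obtain ⟨l, h1, h2, rfl⟩ := wl_spec hS x
  rw [List.prod_inv_reverse, ← h1]
  refine (wl_le _ fun z hz => ?_).trans (by simp)
  simp only [List.mem_reverse, List.mem_map] at hz
  obtain ⟨a, ha, rfl⟩ := hz
  rw [inv_inv]
  exact (h2 a ha).symm

lemma wl_fin (S : Finset G) (n : ℕ) :
    {x : G | ∃ l : List G, l.length = n ∧ (∀ y ∈ l, y ∈ (S : Set G) ∨ y⁻¹ ∈ (S : Set G)) ∧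
      l.prod = x}.Finite := by
  induction n with
  | zero =>
    refine (Set.finite_singleton (1 : G)).subset ?_
    rintro x ⟨l, hl, _, rfl⟩
    rw [List.length_eq_zero_iff] at hl
    simp [hl]
  | succ n ih =>
    have hT : {y : G | y ∈ (S : Set G) ∨ y⁻¹ ∈ (S : Set G)}.Finite := by
      refine Set.Finite.union S.finite_toSet ?_
      exact S.finite_toSet.preimage inv_injective.injOn
    refine (hT.image2 (fun a b => a * b) ih).subset ?_
    rintro x ⟨l, hl, h2, rfl⟩
    cases l with
    | nil => simp at hl
    | cons a l =>
      refine ⟨a, h2 a (by simp), l.prod, ⟨l, by simpa using hl, fun y hy => h2 y (by simp [hy]),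
        rfl⟩, by simp⟩

lemma hypLen (S : Finset G) (hgen : Subgroup.closure (S : Set G) = ⊤)
    (δ : ℝ) (hδ : 0 ≤ δ) (hhyp : GromovFourPoint (S : Set G) δ) :
    HypLen (fun x => (wordLength (S : Set G) x : ℝ)) δ where
  hδ := hδ
  one := by
    have := wl_le (S := (S : Set G)) [] (by simp)
    simp only [List.prod_nil, List.length_nil, Nat.le_zero] at this
    exact_mod_cast this
  inv x := by
    have h1 := wl_inv_le hgen x
    have h2 := wl_inv_le hgen x⁻¹
    rw [inv_inv] at h2
    exact_mod_cast le_antisymm h1 h2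
  mul x y := by exact_mod_cast wl_mul hgen x y
  four x y z w := hhyp x y z w
  fin r := by
    refine ((Set.finite_Iic ⌊r⌋₊).biUnion (fun n _ => wl_fin S n)).subset ?_
    intro x hx
    simp only [Set.mem_iUnion]
    exact ⟨wordLength (S : Set G) x, Nat.le_floor hx, wl_spec hgen x⟩
  mid x := by
    obtain ⟨l, h1, h2, h3⟩ := wl_spec hgen x
    set L := wordLength (S : Set G) x with hL
    have a1 := wl_le (S := (S : Set G)) (l.take (L / 2))
      (fun y hy => h2 y (List.mem_of_mem_take hy))
    have a2 := wl_le (S := (S : Set G)) (l.drop (L / 2))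
      (fun y hy => h2 y (List.mem_of_mem_drop hy))
    have e : (l.take (L / 2)).prod * (l.drop (L / 2)).prod = x := by
      rw [List.prod_take_mul_prod_drop, h3]
    have a3 := wl_mul hgen (l.take (L / 2)).prod (l.drop (L / 2)).prod
    rw [e, ← hL] at a3
    rw [List.length_take, h1] at a1
    rw [List.length_drop, h1] at a2
    refine ⟨(l.take (L / 2)).prod, ?_⟩
    have e2 : (l.take (L / 2)).prod⁻¹ * x = (l.drop (L / 2)).prod := by
      rw [inv_mul_eq_iff_eq_mul, e]
    rw [e2]
    generalize wordLength (S : Set G) (l.take (L / 2)).prod = u at *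
    generalize wordLength (S : Set G) (l.drop (L / 2)).prod = v at *
    have b1 : u + v = L := by omega
    have b2 : L ≤ 2 * u + 1 := by omega
    have b3 : 2 * u ≤ L + 1 := by omega
    have b1' : (u : ℝ) + v = L := by exact_mod_cast b1
    have b2' : (L : ℝ) ≤ 2 * u + 1 := by exact_mod_cast b2
    have b3' : 2 * (u : ℝ) ≤ L + 1 := by exact_mod_cast b3
    exact ⟨b1', by linarith, b3'⟩

end

end HypAux

/-- If `g` has infinite order in a word-hyperbolic group with hyperbolicity witnessed by
the finite generating set `S`, and `c₁, …, cₜ ∉ E(g)`, then for every `R > 0` there are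
positive integers `n₁, …, nₜ` such that every nontrivial element of the subgroup generated
by the elements `g^{nⱼ} cⱼ g^{10 nⱼ}` has word length at least `R`. -/
theorem exists_powers_subgroup_wordLength_ge {G : Type*} [Group G]
    (S : Finset G) (hgen : Subgroup.closure (S : Set G) = ⊤)
    (δ : ℝ) (hδ : 0 ≤ δ) (hhyp : GromovFourPoint (S : Set G) δ)
    (g : G) (hg : ¬IsOfFinOrder g)
    (t : ℕ) (c : Fin t → G) (hc : ∀ j, c j ∉ Esub g) :
    ∀ R : ℝ, 0 < R → ∃ n : Fin t → ℕ, (∀ j, 0 < n j) ∧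
      ∀ w ∈ Subgroup.closure {x : G | ∃ j : Fin t, x = g ^ (n j) * c j * g ^ (10 * n j)},
        w ≠ 1 → (wordLength (S : Set G) w : ℝ) ≥ R := by
  intro R _
  exact (HypAux.hypLen S hgen δ hδ hhyp).main hg c hc R
end
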